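/- Let N be a symbolically compact high-level Petri net with bound n on the number of transition firings needed to reach every reachable marking, and let ≺ be an adequate order on the finite configurations of its symbolic unfolding Υ satisfying |C1| < |C2| ⇒ C1 ≺ C2. Then for every chain of events e1 < e2 < … < e_{n+1} in Υ, the event e_{n+1} is a cut-off* event; consequently every event e in the prefix of Υ containing no proper cut-off* predecessors satisfies depth(e) ≤ n + 1. -/

import Mathlib

/-
Core formalization of high-level Petri nets, symbolic unfoldings,
branching processes, configurations, adequate orders, cut-off events,
expansions and constraints, following Würdemann–Chatain–Haar–Panneke,
"Taking Complete Finite Prefixes To High Level, Symbolically".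
-/

noncomputable section
open scoped Classical

/-- A high-level Petri net over a set `Color` of colors and a set `Var` of variables:
places, transitions, a flow function (given by the multisets of `(place, variable)`
pairs on the input resp. output arcs of each transition), a guard for each transition
(a predicate on the assignments of colors to variables), and a set of initial markings. -/
structure HLNet (Color : Type) (Var : Type) : Type 1 where
  Place : Type
  Trans : Type
  preFlow : Trans → Multiset (Place × Var)
  postFlow : Trans → Multiset (Place × Var)
  guard : Trans → (Var → Color) → Prop
  init : Set (Multiset (Place × Color))

namespace HLNet

variable {Color Var : Type}

/-- A marking: a multiset over `Place × Color`. -/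
abbrev Marking (N : HLNet Color Var) : Type := Multiset (N.Place × Color)

/-- Well-formedness: the set of initial markings is nonempty, and all initial markings
mark the same places with the same numbers of colors. -/
def WellFormed (N : HLNet Color Var) : Prop :=
  N.init.Nonempty ∧
    ∀ M ∈ N.init, ∀ M' ∈ N.init, Multiset.map Prod.fst M = Multiset.map Prod.fst M'

/-- The net is finite: finitely many places and transitions
(the support of the flow function is then automatically finite). -/
def NetFinite (N : HLNet Color Var) : Prop := Finite N.Place ∧ Finite N.Trans

/-- The guards are written in a decidable theory (stand-in: each guard is a
decidable predicate on modes). -/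
def DecidableGuards (N : HLNet Color Var) : Prop :=
  ∀ t σ, Nonempty (Decidable (N.guard t σ))

/-- `•(t,σ)`, the multiset of colored tokens consumed by transition `t` fired in mode `σ`. -/
def preMark (N : HLNet Color Var) (t : N.Trans) (σ : Var → Color) : N.Marking :=
  (N.preFlow t).map fun pv => (pv.1, σ pv.2)

/-- `(t,σ)•`, the multiset of colored tokens produced by transition `t` fired in mode `σ`. -/
def postMark (N : HLNet Color Var) (t : N.Trans) (σ : Var → Color) : N.Marking :=
  (N.postFlow t).map fun pv => (pv.1, σ pv.2)

/-- `M[t,σ⟩`: transition `t` can fire in mode `σ` from marking `M`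
(`σ` is a mode of `t`, i.e. the guard holds, and `•(t,σ) ≤ M`). -/
def fires (N : HLNet Color Var) (M : N.Marking) (t : N.Trans) (σ : Var → Color) : Prop :=
  N.guard t σ ∧ N.preMark t σ ≤ M

/-- `M[t,σ⟩M'`: firing `t` in mode `σ` from `M` yields `M'`. -/
def firesTo (N : HLNet Color Var) (M : N.Marking) (t : N.Trans) (σ : Var → Color)
    (M' : N.Marking) : Prop :=
  N.fires M t σ ∧ M' = (M - N.preMark t σ) + N.postMark t σ

/-- `R(N)`: the markings reachable from some initial marking by finitely many firings. -/
inductive Reach (N : HLNet Color Var) : N.Marking → Prop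
  | init {M : N.Marking} : M ∈ N.init → Reach N M
  | step {M : N.Marking} {t : N.Trans} {σ : Var → Color} {M' : N.Marking} :
      Reach N M → N.firesTo M t σ M' → Reach N M'

/-- The markings reachable in exactly `n` firings. -/
def ReachSteps (N : HLNet Color Var) : ℕ → N.Marking → Prop
  | 0, M => M ∈ N.init
  | n + 1, M' => ∃ M t σ, ReachSteps N n M ∧ N.firesTo M t σ M'

/-- Every reachable marking is reachable by firing at most `n` transitions. -/
def BoundedReach (N : HLNet Color Var) (n : ℕ) : Prop :=
  ∀ M, N.Reach M → ∃ k ≤ n, N.ReachSteps k M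

/-- Safety: in every reachable marking every place holds at most one color. -/
def Safe (N : HLNet Color Var) : Prop :=
  ∀ M, N.Reach M → ∀ p : N.Place, (M.filter fun pc => pc.1 = p).card ≤ 1

/-- Nodes of the net: places and transitions. -/
abbrev Node (N : HLNet Color Var) : Type := N.Place ⊕ N.Trans

/-- The arc relation `x → y` between nodes. -/
def arc (N : HLNet Color Var) : N.Node → N.Node → Prop
  | Sum.inl b, Sum.inr t => ∃ v, (b, v) ∈ N.preFlow t
  | Sum.inr t, Sum.inl b => ∃ v, (b, v) ∈ N.postFlow t
  | Sum.inl _, Sum.inl _ => False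
  | Sum.inr _, Sum.inr _ => False

/-- The causality relation `<` (irreflexive transitive closure of the arc relation). -/
def clt (N : HLNet Color Var) : N.Node → N.Node → Prop := Relation.TransGen N.arc

/-- The causality relation `≤` (reflexive transitive closure of the arc relation). -/
def cle (N : HLNet Color Var) : N.Node → N.Node → Prop := Relation.ReflTransGen N.arc

/-- `<` on transitions/events. -/
def evLT (N : HLNet Color Var) (e e' : N.Trans) : Prop := N.clt (Sum.inr e) (Sum.inr e')

/-- `≤` on transitions/events. -/
def evLE (N : HLNet Color Var) (e e' : N.Trans) : Prop := N.cle (Sum.inr e) (Sum.inr e')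

/-- Structural conflict `x ♯ y`: distinct transitions sharing an input place
causally precede `x` and `y` respectively. -/
def SConflict (N : HLNet Color Var) (x y : N.Node) : Prop :=
  ∃ (b : N.Place) (t1 t2 : N.Trans), t1 ≠ t2 ∧
    (∃ v, (b, v) ∈ N.preFlow t1) ∧ (∃ v, (b, v) ∈ N.preFlow t2) ∧
    N.cle (Sum.inr t1) x ∧ N.cle (Sum.inr t2) y

/-- Ordinariness: at most one arc connects any two nodes. -/
def Ordinary (N : HLNet Color Var) : Prop :=
  (∀ (t : N.Trans) (b : N.Place), ((N.preFlow t).filter fun pv => pv.1 = b).card ≤ 1) ∧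
  (∀ (t : N.Trans) (b : N.Place), ((N.postFlow t).filter fun pv => pv.1 = b).card ≤ 1)

/-- A high-level occurrence net: an ordinary well-formed high-level Petri net
(places = conditions, transitions = events) such that no event is in structural
self-conflict, no node is its own causal predecessor, causality is well-founded,
and each condition either has no incoming arc and is marked with exactly one color
in all initial cuts, or has a unique incoming arc and is unmarked in all initial cuts. -/
def IsOccNet (O : HLNet Color Var) : Prop :=
  O.WellFormed ∧ O.Ordinary ∧
  (∀ e : O.Trans, ¬ O.SConflict (Sum.inr e) (Sum.inr e)) ∧
  (∀ x : O.Node, ¬ O.clt x x) ∧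
  WellFounded O.clt ∧
  (∀ b : O.Place,
    ((∀ (e : O.Trans) (v : Var), (b, v) ∉ O.postFlow e) ∧
      ∀ K ∈ O.init, (K.filter fun bc => bc.1 = b).card = 1) ∨
    ((∃ (e : O.Trans) (v : Var), (b, v) ∈ O.postFlow e ∧
        ∀ (e' : O.Trans) (v' : Var), (b, v') ∈ O.postFlow e' → e' = e ∧ v' = v) ∧
      ∀ K ∈ O.init, (K.filter fun bc => bc.1 = b).card = 0))

/-- `•b = (e(b), v(b))`: the unique input event and arc-variable of a condition,
or `none` for the `⊥`-conditions (the conditions marked in all initial cuts). -/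
def condPre (O : HLNet Color Var) (b : O.Place) : Option (O.Trans × Var) :=
  if h : ∃ ev : O.Trans × Var, (b, ev.2) ∈ O.postFlow ev.1 then some h.choose else none

/-- An assignment of colors to the indexed variables: the variables `v_e` for events `e`
(`Sum.inl (e, v)`), and the variables `v^b_⊥` for conditions `b` (`Sum.inr b`). -/
abbrev Assign (O : HLNet Color Var) : Type := ((O.Trans × Var) ⊕ O.Place) → Color

/-- The color placed on condition `b` under assignment `ι`:
the value of `v(b)_{e(b)}`, resp. `v^b_⊥`. -/
def valOf (O : HLNet Color Var) (ι : O.Assign) (b : O.Place) : Color :=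
  match O.condPre b with
  | none => ι (Sum.inr b)
  | some ev => ι (Sum.inl ev)

/-- `pred(⊥)`: `ι` chooses one of the initial cuts. -/
def predBot (O : HLNet Color Var) (ι : O.Assign) : Prop :=
  ∃ K ∈ O.init, ∀ (b : O.Place) (c : Color), (b, c) ∈ K → ι (Sum.inr b) = c

/-- `loc(e)`: the local predicate of an event. -/
def locPred (O : HLNet Color Var) (e : O.Trans) (ι : O.Assign) : Prop :=
  O.guard e (fun v => ι (Sum.inl (e, v))) ∧
  ∀ bv ∈ O.preFlow e, ι (Sum.inl (e, bv.2)) = O.valOf ι bv.1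

/-- `pred(e) = pred(⊥) ∧ ⋀_{e' ≤ e} loc(e')`. -/
def pred (O : HLNet Color Var) (e : O.Trans) (ι : O.Assign) : Prop :=
  O.predBot ι ∧ ∀ e', O.evLE e' e → O.locPred e' ι

/-- `pred(e(b))` for a condition `b` (which is `pred(⊥)` for `⊥`-conditions). -/
def condPred (O : HLNet Color Var) (b : O.Place) (ι : O.Assign) : Prop :=
  match O.condPre b with
  | none => O.predBot ι
  | some ev => O.pred ev.1 ι

/-- An instantiation of a set `C` of events: an assignment satisfying `pred(e)` for
every `e ∈ C ∪ {⊥}`. -/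
def IsInst (O : HLNet Color Var) (C : Set O.Trans) (ι : O.Assign) : Prop :=
  O.predBot ι ∧ ∀ e ∈ C, O.pred e ι

/-- A configuration: a causally closed set of events free of structural conflict
and of color conflict. -/
def IsConfig (O : HLNet Color Var) (C : Set O.Trans) : Prop :=
  (∀ e ∈ C, ∀ e', O.evLE e' e → e' ∈ C) ∧
  (∀ e ∈ C, ∀ e' ∈ C, ¬ O.SConflict (Sum.inr e) (Sum.inr e')) ∧
  ∃ ι, O.IsInst C ι

/-- A finite configuration. -/
def FinCfg (O : HLNet Color Var) (C : Set O.Trans) : Prop := O.IsConfig C ∧ C.Finite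

/-- The cone configuration `[e] = {e' : e' ≤ e}` of an event. -/
def cone (O : HLNet Color Var) (e : O.Trans) : Set O.Trans := {e' | O.evLE e' e}

/-- `B0`: the conditions marked in all initial cuts (those with `•b = (⊥, v^b)`). -/
def B0 (O : HLNet Color Var) : Set O.Place := {b | O.condPre b = none}

/-- `C→`: the conditions in the postsets of the events of `C`. -/
def postConds (O : HLNet Color Var) (C : Set O.Trans) : Set O.Place :=
  {b | ∃ e ∈ C, ∃ v, (b, v) ∈ O.postFlow e}

/-- `→C`: the conditions in the presets of the events of `C`. -/
def preConds (O : HLNet Color Var) (C : Set O.Trans) : Set O.Place :=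
  {b | ∃ e ∈ C, ∃ v, (b, v) ∈ O.preFlow e}

/-- `Cut(C) = (B0 ∪ C→) \ →C`. -/
def cut (O : HLNet Color Var) (C : Set O.Trans) : Set O.Place :=
  (O.B0 ∪ O.postConds C) \ O.preConds C

/-- `Cut(C, ι)` as a marking of the occurrence net (requires `Cut(C)` to be finite). -/
def cutMark (O : HLNet Color Var) {C : Set O.Trans} (hfin : (O.cut C).Finite)
    (ι : O.Assign) : O.Marking :=
  hfin.toFinset.val.map fun b => (b, O.valOf ι b)

/-- `Cut(C, ι) = {(b, ι(v(b)_{e(b)})) : b ∈ Cut(C)}` as a set. -/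
def cutSet (O : HLNet Color Var) (C : Set O.Trans) (ι : O.Assign) : Set (O.Place × Color) :=
  {bc | bc.1 ∈ O.cut C ∧ bc.2 = O.valOf ι bc.1}

/-- `Cuts(C) = {Cut(C,ι) : ι ∈ I(C)}`. -/
def cuts (O : HLNet Color Var) (C : Set O.Trans) : Set (Set (O.Place × Color)) :=
  {K | ∃ ι, O.IsInst C ι ∧ K = O.cutSet C ι}

/-- `Cuts(C)` as a set of markings of the occurrence net. -/
def cutMarks (O : HLNet Color Var) (C : Set O.Trans) : Set O.Marking :=
  {K | ∃ ι, O.IsInst C ι ∧ ∃ hfin : (O.cut C).Finite, K = O.cutMark hfin ι}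

/-- A homomorphism of high-level nets: maps places to places and transitions to
transitions, preserving guards and the presets and postsets of transitions. -/
structure Hom (O N : HLNet Color Var) where
  mapP : O.Place → N.Place
  mapT : O.Trans → N.Trans
  guard_iff : ∀ (e : O.Trans) (σ : Var → Color), O.guard e σ ↔ N.guard (mapT e) σ
  pre_eq : ∀ e : O.Trans, N.preFlow (mapT e) = (O.preFlow e).map fun bv => (mapP bv.1, bv.2)
  post_eq : ∀ e : O.Trans, N.postFlow (mapT e) = (O.postFlow e).map fun bv => (mapP bv.1, bv.2)

/-- The image of a marking under a homomorphism. -/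
def Hom.mapMarking {O N : HLNet Color Var} (φ : Hom O N) (M : O.Marking) : N.Marking :=
  M.map fun bc => (φ.mapP bc.1, bc.2)

/-- An initial homomorphism: it maps the initial markings onto the initial markings. -/
def Hom.Initial {O N : HLNet Color Var} (φ : Hom O N) : Prop :=
  φ.mapMarking '' O.init = N.init

/-- `Mark(C, ι)`: the marking of `N` represented by the cut of an instantiated
configuration. -/
def mark {O N : HLNet Color Var} (h : Hom O N) {C : Set O.Trans}
    (hfin : (O.cut C).Finite) (ι : O.Assign) : N.Marking :=
  hfin.toFinset.val.map fun b => (h.mapP b, O.valOf ι b)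

/-- `Marks(C) = {Mark(C,ι) : ι ∈ I(C)}`. -/
def marks {O N : HLNet Color Var} (h : Hom O N) (C : Set O.Trans) : Set N.Marking :=
  {M | ∃ ι, O.IsInst C ι ∧ ∃ hfin : (O.cut C).Finite, M = mark h hfin ι}

/-- `(O, h)` is a symbolic branching process of `N`: `O` is an occurrence net all of
whose event predicates are satisfiable, and `h` is an initial homomorphism that is
injective on events with the same preset. -/
def IsSBP {O N : HLNet Color Var} (h : Hom O N) : Prop :=
  O.IsOccNet ∧ h.Initial ∧ (∀ e : O.Trans, ∃ ι, O.pred e ι) ∧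
  ∀ e e' : O.Trans, O.preFlow e = O.preFlow e' → h.mapT e = h.mapT e' → e = e'

/-- `(O1, h1)` is a prefix of `(O2, h2)`: there is an injective initial homomorphism
`φ : O1 → O2` with `h2 ∘ φ = h1`. -/
def IsPrefix {O1 O2 N : HLNet Color Var} (h1 : Hom O1 N) (h2 : Hom O2 N) : Prop :=
  ∃ φ : Hom O1 O2, φ.Initial ∧ Function.Injective φ.mapP ∧ Function.Injective φ.mapT ∧
    (∀ b, h2.mapP (φ.mapP b) = h1.mapP b) ∧ ∀ e, h2.mapT (φ.mapT e) = h1.mapT e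

/-- `(O, h)` is the symbolic unfolding `Υ(N)` of `N`: the (unique up to isomorphism)
maximal symbolic branching process of `N`. -/
def IsUnfolding {O N : HLNet Color Var} (h : Hom O N) : Prop :=
  IsSBP h ∧ ∀ (O' : HLNet Color Var) (h' : Hom O' N), IsSBP h' → IsPrefix h' h

/-- The net `N` with its set of initial markings replaced by `I`. -/
def withInit (N : HLNet Color Var) (I : Set N.Marking) : HLNet Color Var :=
  { N with init := I }

/-- Restriction of a marking to a subset of the places. -/
def restrictMark (O : HLNet Color Var) (SP : Set O.Place) (M : O.Marking) :
    Multiset (↥SP × Color) :=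
  M.filterMap fun bc => if h : bc.1 ∈ SP then some (⟨bc.1, h⟩, bc.2) else none

/-- The subnet of `O` on the places `SP` and transitions `ST`, with initial markings `I`. -/
def restrict (O : HLNet Color Var) (SP : Set O.Place) (ST : Set O.Trans)
    (I : Set (Multiset (↥SP × Color))) : HLNet Color Var where
  Place := ↥SP
  Trans := ↥ST
  preFlow e := (O.preFlow e.1).filterMap fun bv =>
    if h : bv.1 ∈ SP then some (⟨bv.1, h⟩, bv.2) else none
  postFlow e := (O.postFlow e.1).filterMap fun bv =>
    if h : bv.1 ∈ SP then some (⟨bv.1, h⟩, bv.2) else none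
  guard e σ := O.guard e.1 σ
  init := I

/-- The predicate contributed by a node to a color conflict:
`pred(e)` for an event `e`, `pred(e(b))` for a condition `b`. -/
def nodePred (O : HLNet Color Var) (x : O.Node) (ι : O.Assign) : Prop :=
  match x with
  | Sum.inl b => O.condPred b ι
  | Sum.inr e => O.pred e ι

/-- The nodes of the future `↑C`: nodes not in `C ∪ →C`, not in structural conflict
with any event of `C`, and not in color conflict together with `C`. -/
def futureNode (O : HLNet Color Var) (C : Set O.Trans) (x : O.Node) : Prop :=
  (match x with
   | Sum.inl b => b ∉ O.preConds C
   | Sum.inr e => e ∉ C) ∧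
  (∀ e' ∈ C, ¬ O.SConflict (Sum.inr e') x) ∧
  ∃ ι, O.IsInst C ι ∧ O.nodePred x ι

def futurePlaces (O : HLNet Color Var) (C : Set O.Trans) : Set O.Place :=
  {b | O.futureNode C (Sum.inl b)}

def futureEvents (O : HLNet Color Var) (C : Set O.Trans) : Set O.Trans :=
  {e | O.futureNode C (Sum.inr e)}

/-- The underlying net of the future `↑C` of a configuration `C`, with the cuts of `C`
as initial cuts. -/
def future (O : HLNet Color Var) (C : Set O.Trans) : HLNet Color Var :=
  O.restrict (O.futurePlaces C) (O.futureEvents C)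
    (O.restrictMark (O.futurePlaces C) '' O.cutMarks C)

def futPVal (O : HLNet Color Var) (C : Set O.Trans) : (O.future C).Place → O.Place :=
  fun b => b.1

def futTVal (O : HLNet Color Var) (C : Set O.Trans) : (O.future C).Trans → O.Trans :=
  fun e => e.1

/-- The conditions of the occurrence net `O(C|D)`: `Cut(C) ∪ →D ∪ D→`. -/
def aroundPlaces (O : HLNet Color Var) (C D : Set O.Trans) : Set O.Place :=
  O.cut C ∪ O.preConds D ∪ O.postConds D

/-- The occurrence net `O(C|D)` "around `D` from `Cut(C)`", with initial cuts `Cuts(C)`. -/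
def around (O : HLNet Color Var) (C D : Set O.Trans) : HLNet Color Var :=
  O.restrict (O.aroundPlaces C D) D
    (O.restrictMark (O.aroundPlaces C D) '' O.cutMarks C)

def arPVal (O : HLNet Color Var) (C D : Set O.Trans) : (O.around C D).Place → O.Place :=
  fun b => b.1

def arTVal (O : HLNet Color Var) (C D : Set O.Trans) : (O.around C D).Trans → O.Trans :=
  fun e => e.1

/-- `D` is a suffix of `C`, i.e. `C ⊕ D` is defined: `C` and `D` are disjoint and
`C ∪ D` is a configuration. -/
def IsSuffix (O : HLNet Color Var) (C D : Set O.Trans) : Prop :=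
  Disjoint C D ∧ O.IsConfig (C ∪ D)

/-- `C⟦M⟧D`: some instantiation of `C ⊕ D`, restricted to the variables of `C ∪ {⊥}`,
yields the marking `M` for `C`. -/
def markRel {O N : HLNet Color Var} (h : Hom O N) (C : Set O.Trans) (M : N.Marking)
    (D : Set O.Trans) : Prop :=
  ∃ ι, O.IsInst (C ∪ D) ι ∧ ∃ hfin : (O.cut C).Finite, mark h hfin ι = M

/-- `φ` is a monomorphism `O(C1|D) → ↑C2` preserving the labeling and mapping
`Cut(C1)` onto `Cut(C2)`. -/
def IsCanonMono {O N : HLNet Color Var} (h : Hom O N) (C1 D C2 : Set O.Trans)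
    (φ : Hom (O.around C1 D) (O.future C2)) : Prop :=
  Function.Injective φ.mapP ∧ Function.Injective φ.mapT ∧
  (∀ b, h.mapP (O.futPVal C2 (φ.mapP b)) = h.mapP (O.arPVal C1 D b)) ∧
  (∀ e, h.mapT (O.futTVal C2 (φ.mapT e)) = h.mapT (O.arTVal C1 D e)) ∧
  (fun b => O.futPVal C2 (φ.mapP b)) '' {b | O.arPVal C1 D b ∈ O.cut C1} = O.cut C2

/-- `φ(D)`: the image of the events `D` of `O(C1|D)` under `φ`, as a set of events of `O`. -/
def monoImageD {O : HLNet Color Var} (C1 D C2 : Set O.Trans)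
    (φ : Hom (O.around C1 D) (O.future C2)) : Set O.Trans :=
  {e | ∃ d, O.futTVal C2 (φ.mapT d) = e}

/-- An adequate order on the finite configurations of a symbolic branching process
`(O, h)`: a well-founded strict partial order refining set inclusion and preserved
by finite extensions (via the canonical monomorphism between the futures). -/
def IsAdequate {O N : HLNet Color Var} (h : Hom O N)
    (r : Set O.Trans → Set O.Trans → Prop) : Prop :=
  (∀ C, O.FinCfg C → ¬ r C C) ∧
  (∀ C1 C2 C3, O.FinCfg C1 → O.FinCfg C2 → O.FinCfg C3 → r C1 C2 → r C2 C3 → r C1 C3) ∧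
  WellFounded (fun a b : {C : Set O.Trans // O.FinCfg C} => r a.1 b.1) ∧
  (∀ C1 C2, O.FinCfg C1 → O.FinCfg C2 → C1 ⊂ C2 → r C1 C2) ∧
  (∀ C1 C2 D M, O.FinCfg C1 → O.FinCfg C2 → O.IsSuffix C1 D → D.Finite →
    M ∈ marks h C1 → M ∈ marks h C2 → markRel h C1 M D →
    ∀ φ : Hom (O.around C1 D) (O.future C2), IsCanonMono h C1 D C2 φ →
      r C1 C2 → r (C1 ∪ D) (C2 ∪ monoImageD C1 D C2 φ))

/-- A cut-off event: every marking of its cone configuration is represented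
by the cone configuration of a `≺`-smaller event. -/
def IsCutoff {O N : HLNet Color Var} (h : Hom O N)
    (r : Set O.Trans → Set O.Trans → Prop) (e : O.Trans) : Prop :=
  ∀ M ∈ marks h (O.cone e), ∃ e', r (O.cone e') (O.cone e) ∧ M ∈ marks h (O.cone e')

/-- A cut-off* event: every marking of its cone configuration is represented
by some `≺`-smaller finite configuration. -/
def IsCutoffStar {O N : HLNet Color Var} (h : Hom O N)
    (r : Set O.Trans → Set O.Trans → Prop) (e : O.Trans) : Prop :=
  ∀ M ∈ marks h (O.cone e), ∃ C, O.FinCfg C ∧ r C (O.cone e) ∧ M ∈ marks h C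

/-- The events of the prefix `Fin`: events whose cone contains no cut-off event other
than possibly the event itself. -/
def finEvents {O N : HLNet Color Var} (h : Hom O N)
    (r : Set O.Trans → Set O.Trans → Prop) : Set O.Trans :=
  {e | ∀ e' ∈ O.cone e, e' ≠ e → ¬ IsCutoff h r e'}

/-- The conditions of the prefix `Fin`: the conditions of `B0` and those in the
postsets of the events of `Fin`. -/
def finConds {O N : HLNet Color Var} (h : Hom O N)
    (r : Set O.Trans → Set O.Trans → Prop) : Set O.Place :=
  O.B0 ∪ {b | ∃ e ∈ finEvents h r, ∃ v, (b, v) ∈ O.postFlow e}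

/-- The events of the prefix `Fin` for the cut-off* criterion. -/
def finEventsStar {O N : HLNet Color Var} (h : Hom O N)
    (r : Set O.Trans → Set O.Trans → Prop) : Set O.Trans :=
  {e | ∀ e' ∈ O.cone e, e' ≠ e → ¬ IsCutoffStar h r e'}

/-- The conditions of the prefix `Fin` for the cut-off* criterion. -/
def finCondsStar {O N : HLNet Color Var} (h : Hom O N)
    (r : Set O.Trans → Set O.Trans → Prop) : Set O.Place :=
  O.B0 ∪ {b | ∃ e ∈ finEventsStar h r, ∃ v, (b, v) ∈ O.postFlow e}

/-- Completeness of the sub-branching-process of `(O,h)` on the events `E'`: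
every reachable marking `M` of `N` is `Mark(C,ι)` for a configuration `C ⊆ E'` and
an instantiation `ι ∈ I(C)` such that moreover every transition/mode firable from `M`
is matched by an event of `E'` firable from `Cut(C,ι)`. -/
def CompleteSub {O N : HLNet Color Var} (h : Hom O N) (E' : Set O.Trans) : Prop :=
  ∀ M, N.Reach M → ∃ C, O.IsConfig C ∧ C ⊆ E' ∧ ∃ ι, O.IsInst C ι ∧
    ∃ hfin : (O.cut C).Finite, M = mark h hfin ι ∧
      ∀ (t : N.Trans) (σ : Var → Color), N.fires M t σ →
        ∃ e ∈ E', h.mapT e = t ∧ O.fires (O.cutMark hfin ι) e σ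

/-- Completeness of the branching process `(O, h)`. -/
def Complete {O N : HLNet Color Var} (h : Hom O N) : Prop := CompleteSub h Set.univ

/-- The class `Nf`: finite safe high-level Petri nets with decidable guards and
finitely many reachable markings. -/
def InNf (N : HLNet Color Var) : Prop :=
  N.NetFinite ∧ N.WellFormed ∧ N.Safe ∧ N.DecidableGuards ∧ {M | N.Reach M}.Finite

/-- The class `Nsc` of symbolically compact nets: finite safe high-level Petri nets
with decidable guards admitting a bound on the number of transition firings needed
to reach every reachable marking. -/
def InNsc (N : HLNet Color Var) : Prop :=
  N.NetFinite ∧ N.WellFormed ∧ N.Safe ∧ N.DecidableGuards ∧ ∃ n, N.BoundedReach n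

/-- The modes of a transition. -/
def Mode (N : HLNet Color Var) (t : N.Trans) : Type := {σ : Var → Color // N.guard t σ}

/-- The expansion `Exp(N)`: the P/T Petri net (a high-level net over the trivial sets
of colors and variables) with places `p.c` and transitions `t.σ`. -/
def expand (N : HLNet Color Var) : HLNet Unit Unit where
  Place := N.Place × Color
  Trans := (t : N.Trans) × N.Mode t
  preFlow tσ := (N.preMark tσ.1 tσ.2.1).map fun pc => (pc, ())
  postFlow tσ := (N.postMark tσ.1 tσ.2.1).map fun pc => (pc, ())
  guard _ _ := True
  init := (fun M : N.Marking => M.map fun pc => (pc, ())) '' N.init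

def expPlaceBase (N : HLNet Color Var) : N.expand.Place → N.Place := fun pc => pc.1
def expPlaceColor (N : HLNet Color Var) : N.expand.Place → Color := fun pc => pc.2
def expTransBase (N : HLNet Color Var) : N.expand.Trans → N.Trans := fun tσ => tσ.1
def expTransMode (N : HLNet Color Var) (tσ : N.expand.Trans) : Var → Color := tσ.2.1

/-- The constraint `constr(B')` on a co-set `B'` of conditions, evaluated on an
assignment `a` of colors to the labels `π(B')` (predb(b) for all `b ∈ B'`,
with all bound indexed variables existentially quantified at once). -/
def constrSat {O N : HLNet Color Var} (h : Hom O N) (B' : Set O.Place)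
    (a : N.Place → Color) : Prop :=
  ∃ ι : O.Assign, ∀ b ∈ B', O.condPred b ι ∧ a (h.mapP b) = O.valOf ι b

/-- `φ(E')`: the multiset of the transition labels of a finite set of events. -/
def labelMS {O N : HLNet Color Var} (h : Hom O N) (S : Set O.Trans) : Multiset N.Trans :=
  if hfin : S.Finite then hfin.toFinset.val.map h.mapT else 0

/-- Lexicographic comparison of the `≪`-sorted sequences of two multisets. -/
def msLex {α : Type} (lo : LinearOrder α) (s1 s2 : Multiset α) : Prop :=
  letI := lo
  List.Lex (· < ·) (s1.sort (· ≤ ·)) (s2.sort (· ≤ ·))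

/-- `Min(S)`: the causally minimal events of `S`. -/
def minOf (O : HLNet Color Var) (S : Set O.Trans) : Set O.Trans :=
  {e | e ∈ S ∧ ∀ e' ∈ S, ¬ O.evLT e' e}

/-- What remains of `C` after removing the first `n` blocks of its Foata normal form. -/
def foataResidual (O : HLNet Color Var) (C : Set O.Trans) : ℕ → Set O.Trans
  | 0 => C
  | n + 1 => foataResidual O C n \ O.minOf (foataResidual O C n)

/-- The `n`-th block of the Foata normal form of `C`. -/
def foataBlock (O : HLNet Color Var) (C : Set O.Trans) (n : ℕ) : Set O.Trans :=
  O.minOf (O.foataResidual C n)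

/-- `FC1 ≪ FC2`: comparison of Foata normal forms. -/
def foataLex {O N : HLNet Color Var} (h : Hom O N) (lo : LinearOrder N.Trans)
    (C1 C2 : Set O.Trans) : Prop :=
  ∃ i : ℕ, (∀ j < i, labelMS h (O.foataBlock C1 j) = labelMS h (O.foataBlock C2 j)) ∧
    msLex lo (labelMS h (O.foataBlock C1 i)) (labelMS h (O.foataBlock C2 i))

/-- McMillan's order `≺_M`: comparison by size. -/
def rM {O : HLNet Color Var} (C1 C2 : Set O.Trans) : Prop := C1.ncard < C2.ncard

/-- The order `≺_E`: by size, then lexicographically on sorted label sequences. -/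
def rE {O N : HLNet Color Var} (h : Hom O N) (lo : LinearOrder N.Trans)
    (C1 C2 : Set O.Trans) : Prop :=
  C1.ncard < C2.ncard ∨
    (C1.ncard = C2.ncard ∧ msLex lo (labelMS h C1) (labelMS h C2))

/-- The total order `≺_F`: by size, then lexicographically on sorted label sequences,
then by Foata normal forms. -/
def rF {O N : HLNet Color Var} (h : Hom O N) (lo : LinearOrder N.Trans)
    (C1 C2 : Set O.Trans) : Prop :=
  C1.ncard < C2.ncard ∨
    (C1.ncard = C2.ncard ∧ msLex lo (labelMS h C1) (labelMS h C2)) ∨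
    (labelMS h C1 = labelMS h C2 ∧ foataLex h lo C1 C2)

end HLNet

namespace HLNet

variable {Color Var : Type}

theorem nodup_map_fst_iff {α β : Type} (s : Multiset (α × β)) :
    (s.map Prod.fst).Nodup ↔ ∀ a, (s.filter fun x => x.1 = a).card ≤ 1 := by
  simp only [Multiset.nodup_iff_count_le_one, Multiset.count_map, eq_comm]

/-! ### Occurrence nets -/

section OccNet

variable {O : HLNet Color Var}

theorem IsOccNet.post_unique (hO : O.IsOccNet) {b : O.Place} {e e' : O.Trans} {v v' : Var}
    (h : (b, v) ∈ O.postFlow e) (h' : (b, v') ∈ O.postFlow e') : e' = e ∧ v' = v := by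
  obtain ⟨h1, -⟩ | ⟨⟨e0, v0, -, h0⟩, -⟩ := hO.2.2.2.2.2 b
  · exact absurd h (h1 e v)
  · obtain ⟨rfl, rfl⟩ := h0 _ _ h
    exact h0 _ _ h'

theorem condPre_eq_none_iff {b : O.Place} :
    O.condPre b = none ↔ ∀ e v, (b, v) ∉ O.postFlow e := by
  unfold condPre
  split_ifs with h
  · obtain ⟨ev, hev⟩ := h
    simp only [false_iff, not_forall, not_not]
    exact ⟨_, _, hev⟩
  · simp only [true_iff]
    intro e v hev
    exact h ⟨(e, v), hev⟩

theorem IsOccNet.condPre_eq_some (hO : O.IsOccNet) {b : O.Place} {e : O.Trans} {v : Var}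
    (h : (b, v) ∈ O.postFlow e) : O.condPre b = some (e, v) := by
  have hex : ∃ ev : O.Trans × Var, (b, ev.2) ∈ O.postFlow ev.1 := ⟨(e, v), h⟩
  unfold condPre
  rw [dif_pos hex]
  obtain ⟨h1, h2⟩ := hO.post_unique h hex.choose_spec
  exact congrArg some (Prod.ext h1 h2)

theorem valOf_of_mem_B0 {b : O.Place} (hb : b ∈ O.B0) (ι : O.Assign) :
    O.valOf ι b = ι (Sum.inr b) := by
  have hb' : O.condPre b = none := hb
  simp [valOf, hb']

theorem IsOccNet.valOf_of_mem_post (hO : O.IsOccNet) {b : O.Place} {e : O.Trans} {v : Var}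
    (h : (b, v) ∈ O.postFlow e) (ι : O.Assign) : O.valOf ι b = ι (Sum.inl (e, v)) := by
  simp [valOf, hO.condPre_eq_some h]

theorem mem_B0_or_post (O : HLNet Color Var) (b : O.Place) :
    b ∈ O.B0 ∨ ∃ e v, (b, v) ∈ O.postFlow e := by
  by_cases hb : O.condPre b = none
  · exact Or.inl hb
  · rw [condPre_eq_none_iff] at hb
    push Not at hb
    exact Or.inr hb

theorem not_mem_B0_of_mem_post {b : O.Place} {e : O.Trans} {v : Var}
    (h : (b, v) ∈ O.postFlow e) : b ∉ O.B0 :=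
  fun hb => condPre_eq_none_iff.1 hb e v h

theorem IsOccNet.init_filter (hO : O.IsOccNet) {K : O.Marking} (hK : K ∈ O.init) (b : O.Place) :
    (b ∈ O.B0 ∧ (K.filter fun bc => bc.1 = b).card = 1) ∨
      (b ∉ O.B0 ∧ (K.filter fun bc => bc.1 = b).card = 0) := by
  obtain ⟨h1, h2⟩ | ⟨⟨e, v, h1, -⟩, h2⟩ := hO.2.2.2.2.2 b
  · exact Or.inl ⟨condPre_eq_none_iff.2 h1, h2 K hK⟩
  · exact Or.inr ⟨not_mem_B0_of_mem_post h1, h2 K hK⟩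

theorem IsOccNet.mem_B0_iff (hO : O.IsOccNet) {K : O.Marking} (hK : K ∈ O.init) {b : O.Place} :
    b ∈ O.B0 ↔ b ∈ K.map Prod.fst := by
  have key : b ∈ K.map Prod.fst ↔ 0 < (K.filter fun bc => bc.1 = b).card := by
    rw [Multiset.card_pos_iff_exists_mem]
    simp only [Multiset.mem_map, Multiset.mem_filter]
  rw [key]
  rcases hO.init_filter hK b with ⟨h1, h2⟩ | ⟨h1, h2⟩ <;> simp [h1, h2]

theorem IsOccNet.init_nodup (hO : O.IsOccNet) {K : O.Marking} (hK : K ∈ O.init) :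
    (K.map Prod.fst).Nodup := by
  rw [nodup_map_fst_iff]
  intro b
  rcases hO.init_filter hK b with ⟨-, h2⟩ | ⟨-, h2⟩ <;> omega

theorem IsOccNet.pre_nodup (hO : O.IsOccNet) (e : O.Trans) :
    ((O.preFlow e).map Prod.fst).Nodup :=
  (nodup_map_fst_iff _).2 (hO.2.1.1 e)

theorem IsOccNet.post_nodup (hO : O.IsOccNet) (e : O.Trans) :
    ((O.postFlow e).map Prod.fst).Nodup :=
  (nodup_map_fst_iff _).2 (hO.2.1.2 e)

theorem evLE_refl (e : O.Trans) : O.evLE e e := Relation.ReflTransGen.refl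

theorem evLE_of_flow {b : O.Place} {e e' : O.Trans} {v v' : Var}
    (h : (b, v) ∈ O.postFlow e) (h' : (b, v') ∈ O.preFlow e') : O.evLE e e' :=
  (Relation.ReflTransGen.single (show O.arc (Sum.inr e) (Sum.inl b) from ⟨v, h⟩)).tail
    (show O.arc (Sum.inl b) (Sum.inr e') from ⟨v', h'⟩)

theorem evLE_cases {e e' : O.Trans} (h : O.evLE e e') :
    e = e' ∨ ∃ b e'' v v', (b, v) ∈ O.postFlow e'' ∧ (b, v') ∈ O.preFlow e' ∧
      O.evLE e e'' := by
  rcases Relation.ReflTransGen.cases_tail h with h | ⟨x, hx, hxe⟩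
  · exact Or.inl (Sum.inr_injective h).symm
  · obtain b | e1 := x
    · obtain ⟨v', hv'⟩ := hxe
      rcases Relation.ReflTransGen.cases_tail hx with h | ⟨y, hy, hyb⟩
      · cases h
      · obtain b' | e2 := y
        · exact hyb.elim
        · obtain ⟨v, hv⟩ := hyb
          exact Or.inr ⟨b, e2, v, v', hv, hv', hy⟩
    · exact hxe.elim

theorem evLT.evLE {e e' : O.Trans} (h : O.evLT e e') : O.evLE e e' :=
  Relation.TransGen.to_reflTransGen h

theorem evLE.evLT_of_ne {e e' : O.Trans} (h : O.evLE e e') (hne : e ≠ e') : O.evLT e e' := by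
  rcases Relation.reflTransGen_iff_eq_or_transGen.1 h with h | h
  · exact absurd (Sum.inr_injective h).symm hne
  · exact h

theorem IsOccNet.evLT_irrefl (hO : O.IsOccNet) (e : O.Trans) : ¬ O.evLT e e :=
  hO.2.2.2.1 _

theorem evLT_of_flow {b : O.Place} {e e' : O.Trans} {v v' : Var}
    (h : (b, v) ∈ O.postFlow e) (h' : (b, v') ∈ O.preFlow e') : O.evLT e e' :=
  (Relation.TransGen.single (show O.arc (Sum.inr e) (Sum.inl b) from ⟨v, h⟩)).tail
    (show O.arc (Sum.inl b) (Sum.inr e') from ⟨v', h'⟩)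

theorem wellFounded_clt_iff : WellFounded O.clt ↔ WellFounded O.arc :=
  ⟨fun h => Subrelation.wf (fun hxy => Relation.TransGen.single hxy) h, fun h => h.transGen⟩

theorem sConflict_of_shared {b : O.Place} {e e' : O.Trans} {v v' : Var} (hne : e ≠ e')
    (h : (b, v) ∈ O.preFlow e) (h' : (b, v') ∈ O.preFlow e') :
    O.SConflict (Sum.inr e) (Sum.inr e') :=
  ⟨b, e, e', hne, ⟨v, h⟩, ⟨v', h'⟩, evLE_refl e, evLE_refl e'⟩

/-- In a causally closed set, freeness of structural conflict only has to be checked on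
pairs of distinct events sharing an input condition. -/
theorem not_sConflict_of_closed {C : Set O.Trans}
    (hcl : ∀ e ∈ C, ∀ e', O.evLE e' e → e' ∈ C)
    (hsh : ∀ e ∈ C, ∀ e' ∈ C, ∀ b v v', (b, v) ∈ O.preFlow e → (b, v') ∈ O.preFlow e' → e = e') :
    ∀ e ∈ C, ∀ e' ∈ C, ¬ O.SConflict (Sum.inr e) (Sum.inr e') := by
  rintro e he e' he' ⟨b, t1, t2, hne, ⟨v1, h1⟩, ⟨v2, h2⟩, hl1, hl2⟩
  exact hne (hsh t1 (hcl e he t1 hl1) t2 (hcl e' he' t2 hl2) b v1 v2 h1 h2)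

theorem IsOccNet.cone_finite (hO : O.IsOccNet) (e : O.Trans) : (O.cone e).Finite := by
  suffices H : ∀ x : O.Node, {e' : O.Trans | O.cle (Sum.inr e') x}.Finite from H (Sum.inr e)
  intro x
  induction x using (wellFounded_clt_iff.1 hO.2.2.2.2.1).induction with
  | _ x ih =>
    obtain b | e := x
    · rcases mem_B0_or_post O b with hb | ⟨e0, v0, h0⟩
      · refine Set.Finite.subset Set.finite_empty ?_
        intro e' he'
        rcases Relation.ReflTransGen.cases_tail he' with h | ⟨y, -, hyb⟩
        · cases h
        · obtain b' | e2 := y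
          · exact hyb.elim
          · obtain ⟨v, hv⟩ := hyb
            exact not_mem_B0_of_mem_post hv hb
      · refine (ih (Sum.inr e0) ⟨v0, h0⟩).subset ?_
        intro e' he'
        rcases Relation.ReflTransGen.cases_tail he' with h | ⟨y, hy, hyb⟩
        · cases h
        · obtain b' | e2 := y
          · exact hyb.elim
          · obtain ⟨v, hv⟩ := hyb
            obtain ⟨rfl, -⟩ := hO.post_unique h0 hv
            exact hy
    · have hfin : (⋃ b ∈ ((O.preFlow e).map Prod.fst).toFinset,
          {e' : O.Trans | O.cle (Sum.inr e') (Sum.inl b)}).Finite := by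
        refine Set.Finite.biUnion (Finset.finite_toSet _) ?_
        intro b hb
        obtain ⟨⟨b', v⟩, hbv, rfl⟩ := Multiset.mem_map.1 (Multiset.mem_toFinset.1 hb)
        exact ih (Sum.inl b') ⟨v, hbv⟩
      refine (hfin.insert e).subset ?_
      intro e' he'
      rcases Relation.ReflTransGen.cases_tail he' with h | ⟨y, hy, hyb⟩
      · exact Or.inl (Sum.inr_injective h).symm
      · obtain b | e2 := y
        · obtain ⟨v, hv⟩ := hyb
          refine Or.inr (Set.mem_iUnion₂.2 ⟨b, ?_, hy⟩)
          exact Multiset.mem_toFinset.2 (Multiset.mem_map_of_mem Prod.fst hv)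
        · exact hyb.elim

theorem IsOccNet.cone_isConfig (hO : O.IsOccNet) {e : O.Trans} {ι : O.Assign}
    (hι : O.IsInst (O.cone e) ι) : O.IsConfig (O.cone e) := by
  refine ⟨fun e1 h1 e2 h2 => Relation.ReflTransGen.trans h2 h1, ?_, ι, hι⟩
  rintro e1 h1 e2 h2 ⟨b, t1, t2, hne, hb1, hb2, hl1, hl2⟩
  exact hO.2.2.1 e ⟨b, t1, t2, hne, hb1, hb2, hl1.trans h1, hl2.trans h2⟩

/-! ### Cuts and markings -/

theorem IsOccNet.cut_insert (hO : O.IsOccNet) {C : Set O.Trans} {e : O.Trans}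
    (hcl : ∀ e ∈ C, ∀ e', O.evLE e' e → e' ∈ C) (he : e ∉ C)
    (hpre : ∀ bv ∈ O.preFlow e, bv.1 ∈ O.cut C) :
    O.cut (insert e C) =
      (O.cut C \ {b | b ∈ (O.preFlow e).map Prod.fst}) ∪ {b | b ∈ (O.postFlow e).map Prod.fst} := by
  ext b
  simp only [cut, postConds, preConds, Set.mem_sdiff, Set.mem_union, Set.mem_ofPred_eq,
    Set.mem_insert_iff, Multiset.mem_map, Prod.exists, exists_and_right, exists_eq_right,
    exists_eq_or_imp, not_or]
  constructor
  · rintro ⟨hb | hb | hb, h1, h2⟩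
    · exact Or.inl ⟨⟨Or.inl hb, h2⟩, h1⟩
    · exact Or.inr hb
    · exact Or.inl ⟨⟨Or.inr hb, h2⟩, h1⟩
  · rintro (⟨⟨hb | hb, h2⟩, h1⟩ | ⟨v, hv⟩)
    · exact ⟨Or.inl hb, h1, h2⟩
    · exact ⟨Or.inr (Or.inr hb), h1, h2⟩
    · refine ⟨Or.inr (Or.inl ⟨v, hv⟩), ?_, ?_⟩
      · rintro ⟨v', hv'⟩
        rcases (hpre _ hv').1 with hb | ⟨e', he', w, hw⟩
        · exact not_mem_B0_of_mem_post hv hb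
        · obtain ⟨rfl, -⟩ := hO.post_unique hv hw
          exact he he'
      · rintro ⟨e', he', v', hv'⟩
        exact he (hcl e' he' e (evLE_of_flow hv hv'))

theorem mem_marks_iff {N : HLNet Color Var} {h : Hom O N} {C : Set O.Trans} {M : N.Marking} :
    M ∈ marks h C ↔ ∃ ι, O.IsInst C ι ∧ ∃ S : Finset O.Place, (S : Set O.Place) = O.cut C ∧
      M = S.val.map fun b => (h.mapP b, O.valOf ι b) := by
  constructor
  · rintro ⟨ι, hι, hfin, rfl⟩
    exact ⟨ι, hι, hfin.toFinset, hfin.coe_toFinset, rfl⟩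
  · rintro ⟨ι, hι, S, hS, rfl⟩
    have hfin : (O.cut C).Finite := hS ▸ S.finite_toSet
    refine ⟨ι, hι, hfin, ?_⟩
    have : hfin.toFinset = S := by
      apply Finset.coe_injective
      rw [hfin.coe_toFinset, hS]
    simp only [mark, this]

/-- Adding an enabled event to a causally closed set corresponds to firing its label. -/
theorem IsOccNet.exists_cut_insert {N : HLNet Color Var} (hO : O.IsOccNet) (h : Hom O N)
    {C : Set O.Trans} {e : O.Trans} {ι : O.Assign}
    (hcl : ∀ e ∈ C, ∀ e', O.evLE e' e → e' ∈ C) (he : e ∉ C)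
    (hpre : ∀ bv ∈ O.preFlow e, bv.1 ∈ O.cut C) (hloc : O.locPred e ι)
    {S : Finset O.Place} (hS : (S : Set O.Place) = O.cut C) :
    ∃ S' : Finset O.Place, (S' : Set O.Place) = O.cut (insert e C) ∧
      N.firesTo (S.val.map fun b => (h.mapP b, O.valOf ι b)) (h.mapT e)
        (fun v => ι (Sum.inl (e, v))) (S'.val.map fun b => (h.mapP b, O.valOf ι b)) := by
  set P : Finset O.Place := ⟨_, hO.pre_nodup e⟩ with hP
  set Q : Finset O.Place := ⟨_, hO.post_nodup e⟩ with hQ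
  have hPS : P ⊆ S := by
    intro b hb
    obtain ⟨bv, hbv, rfl⟩ := Multiset.mem_map.1 (show b ∈ (O.preFlow e).map Prod.fst from hb)
    rw [← Finset.mem_coe, hS]
    exact hpre bv hbv
  have hdisj : Disjoint (S \ P) Q := by
    rw [Finset.disjoint_left]
    intro b hb hbQ
    obtain ⟨bv, hbv, rfl⟩ := Multiset.mem_map.1 (show b ∈ (O.postFlow e).map Prod.fst from hbQ)
    have hb' : bv.1 ∈ O.cut C := by
      rw [← hS]
      exact (Finset.mem_sdiff.1 hb).1
    rcases hb'.1 with hb0 | ⟨e', he', w, hw⟩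
    · exact not_mem_B0_of_mem_post (v := bv.2) hbv hb0
    · obtain ⟨rfl, -⟩ := hO.post_unique (v := bv.2) hbv hw
      exact he he'
  have hSval : S.val = (S \ P).val + P.val := by
    rw [Finset.sdiff_val, tsub_add_cancel_of_le (Finset.val_le_iff.2 hPS)]
  have hpreM : N.preMark (h.mapT e) (fun v => ι (Sum.inl (e, v))) =
      P.val.map fun b => (h.mapP b, O.valOf ι b) := by
    simp only [preMark, h.pre_eq, hP, Multiset.map_map, Function.comp_def]
    refine Multiset.map_congr rfl fun bv hbv => ?_
    rw [hloc.2 bv hbv]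
  have hpostM : N.postMark (h.mapT e) (fun v => ι (Sum.inl (e, v))) =
      Q.val.map fun b => (h.mapP b, O.valOf ι b) := by
    simp only [postMark, h.post_eq, hQ, Multiset.map_map, Function.comp_def]
    refine Multiset.map_congr rfl fun bv hbv => ?_
    rw [hO.valOf_of_mem_post (v := bv.2) hbv]
  refine ⟨(S \ P).disjUnion Q hdisj, ?_, ⟨(h.guard_iff e _).1 hloc.1, ?_⟩, ?_⟩
  · rw [hO.cut_insert hcl he hpre, Finset.disjUnion_eq_union, Finset.coe_union, Finset.coe_sdiff,
      hS]
    rfl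
  · rw [hpreM]
    exact Multiset.map_le_map (Finset.val_le_iff.2 hPS)
  · rw [hpreM, hpostM, hSval, Multiset.map_add, add_tsub_cancel_right, ← Multiset.map_add]
    rfl

/-- Adding an enabled event to an instantiated configuration yields a configuration, with an
instantiation unchanged on the cut. -/
theorem IsOccNet.exists_inst_insert (hO : O.IsOccNet) {C : Set O.Trans} {e : O.Trans}
    {ι : O.Assign} {σ : Var → Color} (hC : O.IsConfig C) (hι : O.IsInst C ι) (he : e ∉ C)
    (hpre : ∀ bv ∈ O.preFlow e, bv.1 ∈ O.cut C) (hg : O.guard e σ)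
    (hσ : ∀ bv ∈ O.preFlow e, σ bv.2 = O.valOf ι bv.1) :
    O.IsConfig (insert e C) ∧ ∃ ι', O.IsInst (insert e C) ι' ∧ O.locPred e ι' ∧
      (∀ v, ι' (Sum.inl (e, v)) = σ v) ∧ ∀ b ∈ O.cut C, O.valOf ι' b = O.valOf ι b := by
  let ι' : O.Assign := fun x => match x with
    | Sum.inl (e', v) => if e' = e then σ v else ι (Sum.inl (e', v))
    | Sum.inr b => ι (Sum.inr b)
  have hιe : ∀ v, ι' (Sum.inl (e, v)) = σ v := fun v => by simp [ι']
  have hιne : ∀ e' v, e' ≠ e → ι' (Sum.inl (e', v)) = ι (Sum.inl (e', v)) :=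
    fun e' v hne => by simp [ι', hne]
  have hval : ∀ b, b ∈ O.B0 ∪ O.postConds C → O.valOf ι' b = O.valOf ι b := by
    rintro b (hb | ⟨e', he', v, hv⟩)
    · rw [valOf_of_mem_B0 hb, valOf_of_mem_B0 hb]
    · rw [hO.valOf_of_mem_post hv, hO.valOf_of_mem_post hv, hιne]
      rintro rfl
      exact he he'
  have hlocC : ∀ e' ∈ C, O.locPred e' ι' := by
    intro e' he'
    have hne : e' ≠ e := by rintro rfl; exact he he'
    obtain ⟨hg', hp'⟩ := (hι.2 e' he').2 e' (evLE_refl e')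
    refine ⟨?_, ?_⟩
    · simpa only [hιne _ _ hne] using hg'
    · intro bv hbv
      rw [hιne _ _ hne, hp' bv hbv, hval]
      rcases mem_B0_or_post O bv.1 with hb | ⟨e2, v, hv⟩
      · exact Or.inl hb
      · exact Or.inr ⟨e2, hC.1 e' he' e2 (evLE_of_flow (v' := bv.2) hv hbv), v, hv⟩
  have hloce : O.locPred e ι' := by
    refine ⟨?_, ?_⟩
    · simpa only [hιe] using hg
    · intro bv hbv
      rw [hιe, hσ bv hbv, hval _ (hpre bv hbv).1]
  have hle : ∀ e', O.evLE e' e → e' ∈ insert e C := by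
    intro e' hle
    rcases evLE_cases hle with rfl | ⟨b, e2, v, v', hv, hv', hle'⟩
    · exact Or.inl rfl
    · rcases (hpre _ hv').1 with hb | ⟨e3, he3, w, hw⟩
      · exact absurd hb (not_mem_B0_of_mem_post hv)
      · obtain ⟨rfl, -⟩ := hO.post_unique hv hw
        exact Or.inr (hC.1 _ he3 _ hle')
  have hcl : ∀ e1 ∈ insert e C, ∀ e', O.evLE e' e1 → e' ∈ insert e C := by
    rintro e1 (rfl | h1) e' hle'
    · exact hle e' hle'
    · exact Or.inr (hC.1 e1 h1 e' hle')
  have hloc : ∀ e' ∈ insert e C, O.locPred e' ι' := by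
    rintro e' (rfl | h')
    · exact hloce
    · exact hlocC e' h'
  have hinst : O.IsInst (insert e C) ι' :=
    ⟨hι.1, fun e1 h1 => ⟨hι.1, fun e' he' => hloc e' (hcl e1 h1 e' he')⟩⟩
  refine ⟨⟨hcl, not_sConflict_of_closed hcl ?_, ι', hinst⟩, ι', hinst, hloce, hιe,
    fun b hb => hval b hb.1⟩
  rintro e1 (rfl | h1) e2 (rfl | h2) b v v' hv hv'
  · rfl
  · exact absurd ⟨e2, h2, v', hv'⟩ (hpre _ hv).2
  · exact absurd ⟨e1, h1, v, hv⟩ (hpre _ hv').2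
  · by_contra hne
    exact hC.2.1 e1 h1 e2 h2 (sConflict_of_shared hne hv hv')

theorem IsOccNet.exists_cut_empty {N : HLNet Color Var} (hO : O.IsOccNet) (h : Hom O N)
    {K : O.Marking} (hK : K ∈ O.init) {ι : O.Assign}
    (hι : ∀ (b : O.Place) (c : Color), (b, c) ∈ K → ι (Sum.inr b) = c) :
    ∃ S : Finset O.Place, (S : Set O.Place) = O.cut ∅ ∧
      (S.val.map fun b => (h.mapP b, O.valOf ι b)) = h.mapMarking K := by
  refine ⟨⟨_, hO.init_nodup hK⟩, ?_, ?_⟩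
  · ext b
    simp only [cut, postConds, preConds, Set.mem_empty_iff_false, false_and, exists_false,
      Set.ofPred_false, Set.union_empty, Set.sdiff_empty, hO.mem_B0_iff hK]
    rfl
  · simp only [Hom.mapMarking, Multiset.map_map, Function.comp_def]
    refine Multiset.map_congr rfl fun bc hbc => ?_
    have hb : bc.1 ∈ O.B0 := (hO.mem_B0_iff hK).2 (Multiset.mem_map_of_mem _ hbc)
    rw [valOf_of_mem_B0 hb, hι bc.1 bc.2 hbc]

/-- The marking represented by an instantiated finite configuration is reachable. -/
theorem reach_of_finCfg {N : HLNet Color Var} (hO : O.IsOccNet) {h : Hom O N} (hinit : h.Initial)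
    {C : Set O.Trans} (hC : O.IsConfig C) (hfin : C.Finite) {M : N.Marking}
    (hM : M ∈ marks h C) : N.Reach M := by
  induction hm : C.ncard generalizing C M with
  | zero =>
    obtain rfl := (Set.ncard_eq_zero hfin).1 hm
    obtain ⟨ι, hι, S, hS, rfl⟩ := mem_marks_iff.1 hM
    obtain ⟨K, hK, hKι⟩ := hι.1
    obtain ⟨S', hS', hKM⟩ := hO.exists_cut_empty h hK hKι
    obtain rfl : S = S' := Finset.coe_injective (hS.trans hS'.symm)
    rw [hKM]
    refine Reach.init ?_
    rw [← hinit]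
    exact ⟨K, hK, rfl⟩
  | succ m ih =>
    obtain ⟨ι, hι, S, hS, rfl⟩ := mem_marks_iff.1 hM
    have hne : C.Nonempty := by
      rw [← Set.ncard_pos hfin]
      omega
    obtain ⟨e, heC, hmax⟩ : ∃ e ∈ C, ∀ e' ∈ C, ¬ O.evLT e e' := by
      have : IsStrictOrder O.Trans (fun a b => O.evLT b a) :=
        { irrefl := hO.evLT_irrefl
          trans := fun a b c hab hbc => Relation.TransGen.trans hbc hab }
      have hwf := hfin.wellFoundedOn (r := fun a b => O.evLT b a)
      obtain ⟨x, -, hx⟩ := hwf.has_min Set.univ ⟨⟨hne.some, hne.some_mem⟩, trivial⟩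
      exact ⟨x.1, x.2, fun e' he' => hx ⟨e', he'⟩ trivial⟩
    have hins : insert e (C \ {e}) = C := by simp [Set.insert_eq_of_mem heC]
    have hcl : ∀ e1 ∈ C \ {e}, ∀ e', O.evLE e' e1 → e' ∈ C \ {e} := by
      rintro e1 ⟨h1, hne1⟩ e' hle
      refine ⟨hC.1 e1 h1 e' hle, ?_⟩
      rintro rfl
      exact hmax e1 h1 (evLE.evLT_of_ne hle (fun h => hne1 h.symm))
    have hι' : O.IsInst (C \ {e}) ι := ⟨hι.1, fun e1 h1 => hι.2 e1 h1.1⟩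
    have hC' : O.IsConfig (C \ {e}) :=
      ⟨hcl, fun e1 h1 e2 h2 => hC.2.1 e1 h1.1 e2 h2.1, ι, hι'⟩
    have hpre : ∀ bv ∈ O.preFlow e, bv.1 ∈ O.cut (C \ {e}) := by
      intro bv hbv
      refine ⟨?_, ?_⟩
      · rcases mem_B0_or_post O bv.1 with hb | ⟨e2, v, hv⟩
        · exact Or.inl hb
        · have hlt : O.evLT e2 e := evLT_of_flow (v' := bv.2) hv hbv
          refine Or.inr ⟨e2, ⟨hC.1 e heC e2 hlt.evLE, ?_⟩, v, hv⟩
          rintro rfl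
          exact hO.evLT_irrefl _ hlt
      · rintro ⟨e2, ⟨h2, hne2⟩, v, hv⟩
        exact hC.2.1 e heC e2 h2 (sConflict_of_shared (v := bv.2) (fun h => hne2 h.symm) hbv hv)
    have hcutfin : (O.cut (C \ {e})).Finite := by
      refine (S.finite_toSet.union (Multiset.finite_toSet ((O.preFlow e).map Prod.fst))).subset ?_
      intro b hb
      by_cases hbp : b ∈ (O.preFlow e).map Prod.fst
      · exact Or.inr hbp
      · refine Or.inl ?_
        rw [hS, ← hins, hO.cut_insert hcl (by simp) hpre]
        exact Or.inl ⟨hb, hbp⟩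
    obtain ⟨S', hS', hfire⟩ := hO.exists_cut_insert h hcl (by simp) hpre
      ((hι.2 e heC).2 e (evLE_refl e)) hcutfin.coe_toFinset
    rw [hins] at hS'
    obtain rfl : S = S' := Finset.coe_injective (hS.trans hS'.symm)
    refine Reach.step (ih hC' (hfin.subset Set.sdiff_subset)
      (mem_marks_iff.2 ⟨ι, hι', _, hcutfin.coe_toFinset, rfl⟩) ?_) hfire
    rw [Set.ncard_sdiff_singleton_of_mem heC, hm]
    rfl

end OccNet

/-! ### Transfer along embeddings -/

section Transfer

variable {O₁ O₂ N : HLNet Color Var}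

theorem Hom.mem_pre_iff (φ : Hom O₁ O₂) {b : O₂.Place} {v : Var} {e : O₁.Trans} :
    (b, v) ∈ O₂.preFlow (φ.mapT e) ↔ ∃ b₁, (b₁, v) ∈ O₁.preFlow e ∧ φ.mapP b₁ = b := by
  rw [φ.pre_eq, Multiset.mem_map]
  constructor
  · rintro ⟨⟨b₁, v₁⟩, h, heq⟩
    obtain ⟨h1, h2⟩ := Prod.mk.inj heq
    dsimp only at h1 h2
    subst h2
    exact ⟨b₁, h, h1⟩
  · rintro ⟨b₁, h, rfl⟩
    exact ⟨_, h, rfl⟩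

theorem Hom.mem_post_iff (φ : Hom O₁ O₂) {b : O₂.Place} {v : Var} {e : O₁.Trans} :
    (b, v) ∈ O₂.postFlow (φ.mapT e) ↔ ∃ b₁, (b₁, v) ∈ O₁.postFlow e ∧ φ.mapP b₁ = b := by
  rw [φ.post_eq, Multiset.mem_map]
  constructor
  · rintro ⟨⟨b₁, v₁⟩, h, heq⟩
    obtain ⟨h1, h2⟩ := Prod.mk.inj heq
    dsimp only at h1 h2
    subst h2
    exact ⟨b₁, h, h1⟩
  · rintro ⟨b₁, h, rfl⟩
    exact ⟨_, h, rfl⟩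

/-- The action of a homomorphism on nodes. -/
def Hom.mapN (φ : Hom O₁ O₂) : O₁.Node → O₂.Node := Sum.map φ.mapP φ.mapT

/-- An injective homomorphism whose image contains all producers of conditions in the image. -/
structure Hom.IsBackClosed (φ : Hom O₁ O₂) : Prop where
  injP : Function.Injective φ.mapP
  injT : Function.Injective φ.mapT
  back : ∀ b e₂ v, (φ.mapP b, v) ∈ O₂.postFlow e₂ → ∃ e₁, φ.mapT e₁ = e₂

theorem Hom.IsBackClosed.arc_reflect {φ : Hom O₁ O₂} (hφ : φ.IsBackClosed) {y : O₂.Node}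
    {x : O₁.Node} (h : O₂.arc y (φ.mapN x)) : ∃ x', φ.mapN x' = y ∧ O₁.arc x' x := by
  obtain b | e := x <;> obtain b₂ | e₂ := y
  · exact h.elim
  · obtain ⟨v, hv⟩ := h
    obtain ⟨e₁, rfl⟩ := hφ.back b e₂ v hv
    obtain ⟨b', hb', heq⟩ := φ.mem_post_iff.1 hv
    obtain rfl := hφ.injP heq
    exact ⟨Sum.inr e₁, rfl, v, hb'⟩
  · obtain ⟨v, hv⟩ := h
    obtain ⟨b', hb', rfl⟩ := φ.mem_pre_iff.1 hv
    exact ⟨Sum.inl b', rfl, v, hb'⟩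
  · exact h.elim

theorem Hom.IsBackClosed.acc {φ : Hom O₁ O₂} (hφ : φ.IsBackClosed) {x : O₁.Node}
    (hx : Acc O₁.arc x) : Acc O₂.arc (φ.mapN x) := by
  induction hx with
  | intro x _ ih =>
    refine Acc.intro _ fun y hy => ?_
    obtain ⟨x', rfl, hx'⟩ := hφ.arc_reflect hy
    exact ih x' hx'

theorem Hom.IsBackClosed.cle_reflect {φ : Hom O₁ O₂} (hφ : φ.IsBackClosed) {y : O₂.Node}
    {x : O₁.Node} (h : O₂.cle y (φ.mapN x)) : ∃ x', φ.mapN x' = y ∧ O₁.cle x' x := by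
  induction h using Relation.ReflTransGen.head_induction_on with
  | refl => exact ⟨x, rfl, Relation.ReflTransGen.refl⟩
  | head hyz _ ih =>
    obtain ⟨z, rfl, hz⟩ := ih
    obtain ⟨x', rfl, hx'⟩ := hφ.arc_reflect hyz
    exact ⟨x', rfl, hz.head hx'⟩

theorem Hom.IsBackClosed.evLE_reflect {φ : Hom O₁ O₂} (hφ : φ.IsBackClosed) {e₂ : O₂.Trans}
    {e : O₁.Trans} (h : O₂.evLE e₂ (φ.mapT e)) : ∃ e₁, φ.mapT e₁ = e₂ ∧ O₁.evLE e₁ e := by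
  obtain ⟨b | e₁, h1, h2⟩ := hφ.cle_reflect (x := Sum.inr e) h
  · cases h1
  · exact ⟨e₁, Sum.inr_injective h1, h2⟩

theorem Hom.IsBackClosed.sConflict_reflect {φ : Hom O₁ O₂} (hφ : φ.IsBackClosed)
    {e e' : O₁.Trans} (h : O₂.SConflict (Sum.inr (φ.mapT e)) (Sum.inr (φ.mapT e'))) :
    O₁.SConflict (Sum.inr e) (Sum.inr e') := by
  obtain ⟨b, t1, t2, hne, ⟨v1, h1⟩, ⟨v2, h2⟩, hl1, hl2⟩ := h
  obtain ⟨s1, rfl, hs1⟩ := hφ.evLE_reflect hl1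
  obtain ⟨s2, rfl, hs2⟩ := hφ.evLE_reflect hl2
  obtain ⟨b1, hb1, rfl⟩ := φ.mem_pre_iff.1 h1
  obtain ⟨b2, hb2, heq⟩ := φ.mem_pre_iff.1 h2
  obtain rfl := hφ.injP heq
  exact ⟨b2, s1, s2, fun h => hne (congrArg _ h), ⟨v1, hb1⟩, ⟨v2, hb2⟩, hs1, hs2⟩

theorem Hom.Initial.mapMarking_mem {φ : Hom O₁ O₂} (hi : φ.Initial) {K : O₁.Marking}
    (hK : K ∈ O₁.init) : φ.mapMarking K ∈ O₂.init := by
  rw [← hi]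
  exact ⟨K, hK, rfl⟩

theorem Hom.mapMarking_map_fst (φ : Hom O₁ O₂) (K : O₁.Marking) :
    (φ.mapMarking K).map Prod.fst = (K.map Prod.fst).map φ.mapP := by
  simp only [Hom.mapMarking, Multiset.map_map, Function.comp_def]

theorem Hom.Initial.mem_B0_map {φ : Hom O₁ O₂} (hi : φ.Initial) (h₁ : O₁.IsOccNet)
    (h₂ : O₂.IsOccNet) {b₂ : O₂.Place} : b₂ ∈ O₂.B0 ↔ ∃ b ∈ O₁.B0, φ.mapP b = b₂ := by
  obtain ⟨K, hK⟩ := h₁.1.1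
  simp only [h₁.mem_B0_iff hK, h₂.mem_B0_iff (hi.mapMarking_mem hK), φ.mapMarking_map_fst,
    Multiset.mem_map (f := φ.mapP)]

theorem Hom.Initial.isBackClosed {φ : Hom O₁ O₂} (hi : φ.Initial) (h₁ : O₁.IsOccNet)
    (h₂ : O₂.IsOccNet) (injP : Function.Injective φ.mapP) (injT : Function.Injective φ.mapT) :
    φ.IsBackClosed := by
  refine ⟨injP, injT, fun b e₂ v hv => ?_⟩
  rcases mem_B0_or_post O₁ b with hb | ⟨e₁, v₁, h⟩
  · exact absurd ((hi.mem_B0_map h₁ h₂).2 ⟨b, hb, rfl⟩) (not_mem_B0_of_mem_post hv)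
  · exact ⟨e₁, (h₂.post_unique hv (φ.mem_post_iff.2 ⟨b, h, rfl⟩)).1⟩

/-- `ι₂` extends `ι₁` along `φ`. -/
def Hom.Extends (φ : Hom O₁ O₂) (ι₁ : O₁.Assign) (ι₂ : O₂.Assign) : Prop :=
  (∀ e v, ι₂ (Sum.inl (φ.mapT e, v)) = ι₁ (Sum.inl (e, v))) ∧
    ∀ b, ι₂ (Sum.inr (φ.mapP b)) = ι₁ (Sum.inr b)

theorem Hom.exists_extends {φ : Hom O₁ O₂} (injP : Function.Injective φ.mapP)
    (injT : Function.Injective φ.mapT) (hne : Nonempty O₂.Assign) (ι₁ : O₁.Assign) :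
    ∃ ι₂, φ.Extends ι₁ ι₂ := by
  obtain ⟨ι₀⟩ := hne
  have hinj : Function.Injective (Sum.map (Prod.map φ.mapT (id : Var → Var)) φ.mapP) :=
    Sum.map_injective.2 ⟨Function.Injective.prodMap injT Function.injective_id, injP⟩
  refine ⟨Function.extend (Sum.map (Prod.map φ.mapT id) φ.mapP) ι₁ ι₀, fun e v => ?_, fun b => ?_⟩
  · exact hinj.extend_apply ι₁ ι₀ (Sum.inl (e, v))
  · exact hinj.extend_apply ι₁ ι₀ (Sum.inr b)

theorem Hom.Extends.valOf_eq {φ : Hom O₁ O₂} {ι₁ : O₁.Assign} {ι₂ : O₂.Assign}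
    (hι : φ.Extends ι₁ ι₂) (hi : φ.Initial) (h₁ : O₁.IsOccNet) (h₂ : O₂.IsOccNet)
    (b : O₁.Place) : O₂.valOf ι₂ (φ.mapP b) = O₁.valOf ι₁ b := by
  rcases mem_B0_or_post O₁ b with hb | ⟨e, v, hv⟩
  · rw [valOf_of_mem_B0 hb, valOf_of_mem_B0 ((hi.mem_B0_map h₁ h₂).2 ⟨b, hb, rfl⟩), hι.2]
  · rw [h₁.valOf_of_mem_post hv, h₂.valOf_of_mem_post (φ.mem_post_iff.2 ⟨b, hv, rfl⟩), hι.1]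

theorem Hom.Extends.locPred {φ : Hom O₁ O₂} {ι₁ : O₁.Assign} {ι₂ : O₂.Assign}
    (hι : φ.Extends ι₁ ι₂) (hi : φ.Initial) (h₁ : O₁.IsOccNet) (h₂ : O₂.IsOccNet)
    {e : O₁.Trans} (h : O₁.locPred e ι₁) : O₂.locPred (φ.mapT e) ι₂ := by
  refine ⟨?_, ?_⟩
  · rw [← φ.guard_iff]
    simpa only [hι.1] using h.1
  · rintro ⟨b, v⟩ hbv
    obtain ⟨b₁, hb₁, rfl⟩ := φ.mem_pre_iff.1 hbv
    rw [hι.1, hι.valOf_eq hi h₁ h₂]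
    exact h.2 _ hb₁

theorem Hom.Extends.predBot {φ : Hom O₁ O₂} {ι₁ : O₁.Assign} {ι₂ : O₂.Assign}
    (hι : φ.Extends ι₁ ι₂) (hi : φ.Initial) (h : O₁.predBot ι₁) : O₂.predBot ι₂ := by
  obtain ⟨K, hK, hKι⟩ := h
  refine ⟨_, hi.mapMarking_mem hK, fun b c hbc => ?_⟩
  obtain ⟨⟨b₁, c₁⟩, hbc₁, heq⟩ := Multiset.mem_map.1 hbc
  obtain ⟨rfl, rfl⟩ := Prod.mk.inj heq
  rw [hι.2]
  exact hKι _ _ hbc₁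

theorem Hom.Extends.pred {φ : Hom O₁ O₂} {ι₁ : O₁.Assign} {ι₂ : O₂.Assign}
    (hι : φ.Extends ι₁ ι₂) (hi : φ.Initial) (hφ : φ.IsBackClosed) (h₁ : O₁.IsOccNet)
    (h₂ : O₂.IsOccNet) {e : O₁.Trans} (h : O₁.pred e ι₁) : O₂.pred (φ.mapT e) ι₂ := by
  refine ⟨hι.predBot hi h.1, fun e' he' => ?_⟩
  obtain ⟨e₁, rfl, hle⟩ := hφ.evLE_reflect he'
  exact hι.locPred hi h₁ h₂ (h.2 e₁ hle)

theorem Hom.Extends.isInst {φ : Hom O₁ O₂} {ι₁ : O₁.Assign} {ι₂ : O₂.Assign}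
    (hι : φ.Extends ι₁ ι₂) (hi : φ.Initial) (hφ : φ.IsBackClosed) (h₁ : O₁.IsOccNet)
    (h₂ : O₂.IsOccNet) {C : Set O₁.Trans} (h : O₁.IsInst C ι₁) :
    O₂.IsInst (φ.mapT '' C) ι₂ := by
  refine ⟨hι.predBot hi h.1, ?_⟩
  rintro _ ⟨e, he, rfl⟩
  exact hι.pred hi hφ h₁ h₂ (h.2 e he)

theorem Hom.Extends.isConfig {φ : Hom O₁ O₂} {ι₁ : O₁.Assign} {ι₂ : O₂.Assign}
    (hι : φ.Extends ι₁ ι₂) (hi : φ.Initial) (hφ : φ.IsBackClosed) (h₁ : O₁.IsOccNet)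
    (h₂ : O₂.IsOccNet) {C : Set O₁.Trans} (hC : O₁.IsConfig C) (h : O₁.IsInst C ι₁) :
    O₂.IsConfig (φ.mapT '' C) := by
  refine ⟨?_, ?_, ι₂, hι.isInst hi hφ h₁ h₂ h⟩
  · rintro _ ⟨e, he, rfl⟩ e' hle
    obtain ⟨e₁, rfl, hle₁⟩ := hφ.evLE_reflect hle
    exact ⟨e₁, hC.1 e he e₁ hle₁, rfl⟩
  · rintro _ ⟨e, he, rfl⟩ _ ⟨e', he', rfl⟩ hc
    exact hC.2.1 e he e' he' (hφ.sConflict_reflect hc)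

theorem Hom.IsBackClosed.cut_image {φ : Hom O₁ O₂} (hφ : φ.IsBackClosed) (hi : φ.Initial)
    (h₁ : O₁.IsOccNet) (h₂ : O₂.IsOccNet) (C : Set O₁.Trans) :
    O₂.cut (φ.mapT '' C) = φ.mapP '' O₁.cut C := by
  have hpre : O₂.preConds (φ.mapT '' C) = φ.mapP '' O₁.preConds C := by
    ext b
    constructor
    · rintro ⟨_, ⟨e, he, rfl⟩, v, hv⟩
      obtain ⟨b₁, hb₁, rfl⟩ := φ.mem_pre_iff.1 hv
      exact ⟨b₁, ⟨e, he, v, hb₁⟩, rfl⟩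
    · rintro ⟨b₁, ⟨e, he, v, hb₁⟩, rfl⟩
      exact ⟨_, ⟨e, he, rfl⟩, v, φ.mem_pre_iff.2 ⟨b₁, hb₁, rfl⟩⟩
  have hpost : O₂.postConds (φ.mapT '' C) = φ.mapP '' O₁.postConds C := by
    ext b
    constructor
    · rintro ⟨_, ⟨e, he, rfl⟩, v, hv⟩
      obtain ⟨b₁, hb₁, rfl⟩ := φ.mem_post_iff.1 hv
      exact ⟨b₁, ⟨e, he, v, hb₁⟩, rfl⟩
    · rintro ⟨b₁, ⟨e, he, v, hb₁⟩, rfl⟩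
      exact ⟨_, ⟨e, he, rfl⟩, v, φ.mem_post_iff.2 ⟨b₁, hb₁, rfl⟩⟩
  have hB0 : O₂.B0 = φ.mapP '' O₁.B0 := by
    ext b
    exact hi.mem_B0_map h₁ h₂
  simp only [cut]
  rw [hpre, hpost, hB0, ← Set.image_union, Set.image_sdiff hφ.injP]

theorem Hom.IsBackClosed.exists_cut_image {φ : Hom O₁ O₂} (hφ : φ.IsBackClosed) (hi : φ.Initial)
    (h₁ : O₁.IsOccNet) (h₂ : O₂.IsOccNet) {g₁ : Hom O₁ N} {g₂ : Hom O₂ N}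
    (hg : ∀ b, g₂.mapP (φ.mapP b) = g₁.mapP b) {ι₁ : O₁.Assign} {ι₂ : O₂.Assign}
    (hι : φ.Extends ι₁ ι₂) {C : Set O₁.Trans} {S : Finset O₁.Place}
    (hS : (S : Set O₁.Place) = O₁.cut C) :
    ∃ S' : Finset O₂.Place, (S' : Set O₂.Place) = O₂.cut (φ.mapT '' C) ∧
      (S'.val.map fun b => (g₂.mapP b, O₂.valOf ι₂ b)) =
        S.val.map fun b => (g₁.mapP b, O₁.valOf ι₁ b) := by
  refine ⟨S.map ⟨φ.mapP, hφ.injP⟩, ?_, ?_⟩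
  · rw [Finset.coe_map, hS, hφ.cut_image hi h₁ h₂]
    rfl
  · simp only [Finset.map_val, Multiset.map_map, Function.comp_def, Function.Embedding.coeFn_mk, hg,
      hι.valOf_eq hi h₁ h₂]

end Transfer

/-! ### Extending a branching process by one event -/

section Extension

variable {O N : HLNet Color Var}

/-- The extension of `O` by one new event labelled `t` with input arcs `Z`, together with one
new condition for every output arc of `t`. -/
def extend (O : HLNet Color Var) {N : HLNet Color Var} (t : N.Trans)
    (Z : Multiset (O.Place × Var)) : HLNet Color Var where
  Place := O.Place ⊕ (N.postFlow t).ToType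
  Trans := Option O.Trans
  preFlow e := (e.elim Z O.preFlow).map fun bv => (Sum.inl bv.1, bv.2)
  postFlow e := match e with
    | some e => (O.postFlow e).map fun bv => (Sum.inl bv.1, bv.2)
    | none => (Finset.univ : Finset (N.postFlow t).ToType).val.map fun x => (Sum.inr x, x.1.2)
  guard e := e.elim (N.guard t) O.guard
  init := (fun K : O.Marking => K.map fun bc => (Sum.inl bc.1, bc.2)) '' O.init

/-- The inclusion of `O` into its extension. -/
def extendIncl (O : HLNet Color Var) {N : HLNet Color Var} (t : N.Trans)
    (Z : Multiset (O.Place × Var)) : Hom O (O.extend t Z) where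
  mapP := Sum.inl
  mapT := some
  guard_iff _ _ := Iff.rfl
  pre_eq _ := rfl
  post_eq _ := rfl

/-- The labelling of the extension of a branching process. -/
def extendHom (h : Hom O N) (t : N.Trans) (Z : Multiset (O.Place × Var))
    (hZ : (Z.map fun bv => (h.mapP bv.1, bv.2)) = N.preFlow t) : Hom (O.extend t Z) N where
  mapP := Sum.elim h.mapP fun x => x.1.1
  mapT e := e.elim t h.mapT
  guard_iff e σ := by
    cases e with
    | none => exact Iff.rfl
    | some e => exact h.guard_iff e σ
  pre_eq e := by
    cases e with
    | none => simp [extend, Multiset.map_map, Function.comp_def, ← hZ]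
    | some e => simp [extend, Multiset.map_map, Function.comp_def, h.pre_eq]
  post_eq e := by
    cases e with
    | none =>
      simp only [extend, Option.elim, Multiset.map_map, Function.comp_def, Sum.elim_inr, Prod.eta]
      exact (Multiset.map_univ_coe _).symm
    | some e => simp [extend, Multiset.map_map, Function.comp_def, h.post_eq]

variable {t : N.Trans} {Z : Multiset (O.Place × Var)}

theorem extendIncl_initial : (O.extendIncl t Z).Initial := rfl

theorem not_inl_mem_post_none {b : O.Place} {v : Var} :
    ((Sum.inl b, v) : (O.extend t Z).Place × Var) ∉ (O.extend t Z).postFlow none := by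
  intro h
  obtain ⟨x, -, hx⟩ := Multiset.mem_map.1 h
  cases hx

theorem mem_pre_none {b : (O.extend t Z).Place} {v : Var}
    (h : (b, v) ∈ (O.extend t Z).preFlow none) : ∃ b₀, (b₀, v) ∈ Z ∧ b = Sum.inl b₀ := by
  obtain ⟨⟨b₀, v₀⟩, hx, heq⟩ := Multiset.mem_map.1 h
  obtain ⟨rfl, rfl⟩ := Prod.mk.inj heq
  exact ⟨b₀, hx, rfl⟩

theorem extendIncl_isBackClosed : (O.extendIncl t Z).IsBackClosed where
  injP := Sum.inl_injective
  injT := Option.some_injective _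
  back b e₂ v hv := by
    cases e₂ with
    | none => exact absurd hv not_inl_mem_post_none
    | some e => exact ⟨e, rfl⟩

theorem IsOccNet.extend_closed (hO : O.IsOccNet) {C : Set O.Trans} (hC : O.IsConfig C)
    (hZcut : ∀ bv ∈ Z, bv.1 ∈ O.cut C) {e : Option O.Trans}
    (he : (O.extend t Z).evLE e none) : e = none ∨ ∃ s ∈ C, e = some s := by
  rcases evLE_cases he with h | ⟨b, e₂, v, v', hv, hv', hle⟩
  · exact Or.inl h
  · obtain ⟨b₀, hb₀, rfl⟩ := mem_pre_none hv'
    cases e₂ with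
    | none => exact absurd hv not_inl_mem_post_none
    | some s =>
      obtain ⟨b₁, hb₁, heq⟩ := (O.extendIncl t Z).mem_post_iff.1 hv
      obtain rfl : b₁ = b₀ := Sum.inl_injective heq
      obtain ⟨s', rfl, hs'⟩ := extendIncl_isBackClosed.evLE_reflect hle
      refine Or.inr ⟨s', ?_, rfl⟩
      rcases (hZcut _ hb₀).1 with hb | ⟨e₃, h₃, w, hw⟩
      · exact absurd hb (not_mem_B0_of_mem_post hb₁)
      · obtain ⟨rfl, -⟩ := hO.post_unique hb₁ hw
        exact hC.1 _ h₃ _ hs'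

theorem IsOccNet.extend_isOccNet (hO : O.IsOccNet) {C : Set O.Trans} (hC : O.IsConfig C)
    (hZ : (Z.map Prod.fst).Nodup) (hZcut : ∀ bv ∈ Z, bv.1 ∈ O.cut C) :
    (O.extend t Z).IsOccNet := by
  have hwf : WellFounded (O.extend t Z).arc := by
    have hacc := wellFounded_clt_iff.1 hO.2.2.2.2.1
    have hold : ∀ x : O.Node, Acc (O.extend t Z).arc ((O.extendIncl t Z).mapN x) :=
      fun x => extendIncl_isBackClosed.acc (hacc.apply x)
    have hnone : Acc (O.extend t Z).arc (Sum.inr none) := by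
      refine Acc.intro _ fun y hy => ?_
      obtain b | e := y
      · obtain ⟨v, hv⟩ := hy
        obtain ⟨b₀, -, rfl⟩ := mem_pre_none hv
        exact hold (Sum.inl b₀)
      · exact hy.elim
    have hev : ∀ e : Option O.Trans, Acc (O.extend t Z).arc (Sum.inr e) := by
      rintro (_ | e)
      · exact hnone
      · exact hold (Sum.inr e)
    refine ⟨?_⟩
    rintro (b | e)
    · refine Acc.intro _ fun y hy => ?_
      obtain b | e := y
      · exact hy.elim
      · exact hev e
    · exact hev e
  have hclt : WellFounded (O.extend t Z).clt := wellFounded_clt_iff.2 hwf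
  refine ⟨⟨?_, ?_⟩, ⟨?_, ?_⟩, ?_, ?_, hclt, ?_⟩
  · obtain ⟨K, hK⟩ := hO.1.1
    exact ⟨_, K, hK, rfl⟩
  · rintro _ ⟨K, hK, rfl⟩ _ ⟨K', hK', rfl⟩
    change ((O.extendIncl t Z).mapMarking K).map Prod.fst =
      ((O.extendIncl t Z).mapMarking K').map Prod.fst
    rw [Hom.mapMarking_map_fst, Hom.mapMarking_map_fst, hO.1.2 K hK K' hK']
  · intro e
    rw [← nodup_map_fst_iff]
    have h : ((e.elim Z O.preFlow).map Prod.fst).Nodup := by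
      cases e with
      | none => exact hZ
      | some e => exact hO.pre_nodup e
    have h' := h.map (Sum.inl_injective (β := (N.postFlow t).ToType))
    rw [Multiset.map_map] at h'
    simp only [extend, Multiset.map_map]
    exact h'
  · intro e
    rw [← nodup_map_fst_iff]
    cases e with
    | none =>
      simp only [extend, Multiset.map_map, Function.comp_def]
      exact Finset.univ.nodup.map Sum.inr_injective
    | some e =>
      have h' := (hO.post_nodup e).map (Sum.inl_injective (β := (N.postFlow t).ToType))
      rw [Multiset.map_map] at h'
      simp only [extend, Multiset.map_map]
      exact h'
  · intro e hc
    cases e with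
    | some e => exact hO.2.2.1 e (extendIncl_isBackClosed.sConflict_reflect hc)
    | none =>
      obtain ⟨b, t1, t2, hne, ⟨v1, h1⟩, ⟨v2, h2⟩, hl1, hl2⟩ := hc
      rcases hO.extend_closed hC hZcut hl1 with rfl | ⟨s1, hs1, rfl⟩ <;>
        rcases hO.extend_closed hC hZcut hl2 with rfl | ⟨s2, hs2, rfl⟩
      · exact hne rfl
      · obtain ⟨b₀, hb₀, rfl⟩ := mem_pre_none h1
        obtain ⟨b₁, hb₁, heq⟩ := (O.extendIncl t Z).mem_pre_iff.1 h2
        obtain rfl : b₁ = b₀ := Sum.inl_injective heq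
        exact (hZcut _ hb₀).2 ⟨s2, hs2, v2, hb₁⟩
      · obtain ⟨b₀, hb₀, rfl⟩ := mem_pre_none h2
        obtain ⟨b₁, hb₁, heq⟩ := (O.extendIncl t Z).mem_pre_iff.1 h1
        obtain rfl : b₁ = b₀ := Sum.inl_injective heq
        exact (hZcut _ hb₀).2 ⟨s1, hs1, v1, hb₁⟩
      · obtain ⟨b₀, hb₀, rfl⟩ := (O.extendIncl t Z).mem_pre_iff.1 h1
        obtain ⟨b₁, hb₁, heq⟩ := (O.extendIncl t Z).mem_pre_iff.1 h2
        obtain rfl : b₁ = b₀ := Sum.inl_injective heq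
        exact hC.2.1 s1 hs1 s2 hs2
          (sConflict_of_shared (fun h => hne (congrArg some h)) hb₀ hb₁)
  · exact fun x => hclt.irrefl.irrefl x
  · have hfilter : ∀ K : O.Marking, ∀ b : O.Place,
        (((K.map fun bc => ((Sum.inl bc.1, bc.2) : (O.extend t Z).Place × Color))).filter
          fun bc => bc.1 = Sum.inl b).card = (K.filter fun bc => bc.1 = b).card := by
      intro K b
      rw [Multiset.filter_map, Multiset.card_map]
      congr 1
      refine Multiset.filter_congr fun x _ => ?_
      exact Sum.inl_injective.eq_iff
    rintro (b | x)
    · rcases mem_B0_or_post O b with hb | ⟨e, v, hv⟩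
      · refine Or.inl ⟨fun e v hv => ?_, ?_⟩
        · obtain ⟨e₁, rfl⟩ := extendIncl_isBackClosed.back b e v hv
          obtain ⟨b₁, hb₁, heq⟩ := (O.extendIncl t Z).mem_post_iff.1 hv
          obtain rfl : b₁ = b := Sum.inl_injective heq
          exact not_mem_B0_of_mem_post hb₁ hb
        · rintro _ ⟨K, hK, rfl⟩
          refine (hfilter K b).trans ?_
          rcases hO.init_filter hK b with ⟨-, h⟩ | ⟨h, -⟩
          · exact h
          · exact absurd hb h
      · refine Or.inr ⟨⟨some e, v, (O.extendIncl t Z).mem_post_iff.2 ⟨b, hv, rfl⟩, ?_⟩, ?_⟩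
        · intro e' v' hv'
          obtain ⟨e₁, rfl⟩ := extendIncl_isBackClosed.back b e' v' hv'
          obtain ⟨b₁, hb₁, heq⟩ := (O.extendIncl t Z).mem_post_iff.1 hv'
          obtain rfl : b₁ = b := Sum.inl_injective heq
          obtain ⟨rfl, rfl⟩ := hO.post_unique hv hb₁
          exact ⟨rfl, rfl⟩
        · rintro _ ⟨K, hK, rfl⟩
          refine (hfilter K b).trans ?_
          rcases hO.init_filter hK b with ⟨h, -⟩ | ⟨-, h⟩
          · exact absurd h (not_mem_B0_of_mem_post hv)
          · exact h
    · refine Or.inr ⟨⟨none, x.1.2, Multiset.mem_map.2 ⟨x, Finset.mem_univ x, rfl⟩, ?_⟩, ?_⟩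
      · intro e' v' hv'
        cases e' with
        | none =>
          obtain ⟨y, -, hy⟩ := Multiset.mem_map.1 hv'
          obtain ⟨h1, rfl⟩ := Prod.mk.inj hy
          obtain rfl := Sum.inr_injective h1
          exact ⟨rfl, rfl⟩
        | some e =>
          obtain ⟨b₁, -, heq⟩ := (O.extendIncl t Z).mem_post_iff.1 hv'
          cases heq
      · rintro _ ⟨K, hK, rfl⟩
        refine Multiset.card_eq_zero.2 (Multiset.filter_eq_nil.2 fun bc hbc heq => ?_)
        obtain ⟨bc', -, rfl⟩ := Multiset.mem_map.1 hbc
        cases heq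

/-- If `t` can fire in mode `σ` from the marking of an instantiated configuration `C`, using the
conditions in `Z`, then, possibly after extending the branching process, an event labelled `t`
is enabled after `C`. -/
theorem IsSBP.exists_event {h : Hom O N} (hS : IsSBP h) {C : Set O.Trans} (hC : O.FinCfg C)
    {ι : O.Assign} (hι : O.IsInst C ι) {S : Finset O.Place} (hScut : (S : Set O.Place) = O.cut C)
    (hZt : (Z.map fun bv => (h.mapP bv.1, bv.2)) = N.preFlow t) (hZ : (Z.map Prod.fst).Nodup)
    (hZcut : ∀ bv ∈ Z, bv.1 ∈ O.cut C) {σ : Var → Color} (hg : N.guard t σ)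
    (hσ : ∀ bv ∈ Z, σ bv.2 = O.valOf ι bv.1) :
    ∃ (O' : HLNet Color Var) (h' : Hom O' N) (C' : Set O'.Trans) (ι' : O'.Assign) (e : O'.Trans)
      (S' : Finset O'.Place), IsSBP h' ∧ O'.FinCfg C' ∧ C'.ncard = C.ncard ∧ O'.IsInst C' ι' ∧
      (S' : Set O'.Place) = O'.cut C' ∧
      (S'.val.map fun b => (h'.mapP b, O'.valOf ι' b)) =
        (S.val.map fun b => (h.mapP b, O.valOf ι b)) ∧
      h'.mapT e = t ∧ (∀ bv ∈ O'.preFlow e, bv.1 ∈ O'.cut C') ∧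
      ∀ bv ∈ O'.preFlow e, σ bv.2 = O'.valOf ι' bv.1 := by
  by_cases hex : ∃ e, O.preFlow e = Z ∧ h.mapT e = t
  · obtain ⟨e, rfl, he⟩ := hex
    exact ⟨O, h, C, ι, e, S, hS, hC, rfl, hι, hScut, rfl, he, hZcut, hσ⟩
  have hO := hS.1
  have hO' : (O.extend t Z).IsOccNet := hO.extend_isOccNet hC.1 hZ hZcut
  have hi : (O.extendIncl t Z).Initial := extendIncl_initial
  have hb : (O.extendIncl t Z).IsBackClosed := extendIncl_isBackClosed
  have hne : Nonempty (O.extend t Z).Assign := ⟨fun x => match x with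
    | Sum.inl (some e, v) => ι (Sum.inl (e, v))
    | Sum.inl (none, v) => σ v
    | Sum.inr (Sum.inl b) => ι (Sum.inr b)
    | Sum.inr (Sum.inr x) => σ x.1.2⟩
  obtain ⟨ι', hι'⟩ := Hom.exists_extends hb.injP hb.injT hne ι
  have hinst := hι'.isInst hi hb hO hO' hι
  have hconf := hι'.isConfig hi hb hO hO' hC.1 hι
  obtain ⟨S', hS', hmark⟩ := hb.exists_cut_image hi hO hO' (g₁ := h) (g₂ := extendHom h t Z hZt)
    (fun _ => rfl) hι' hScut
  have hpre : ∀ bv ∈ (O.extend t Z).preFlow none,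
      bv.1 ∈ (O.extend t Z).cut ((O.extendIncl t Z).mapT '' C) := by
    rintro ⟨b, v⟩ hbv
    obtain ⟨b₀, hb₀, rfl⟩ := mem_pre_none hbv
    rw [hb.cut_image hi hO hO']
    exact ⟨b₀, hZcut _ hb₀, rfl⟩
  have hval : ∀ bv ∈ (O.extend t Z).preFlow none, σ bv.2 = (O.extend t Z).valOf ι' bv.1 := by
    rintro ⟨b, v⟩ hbv
    obtain ⟨b₀, hb₀, rfl⟩ := mem_pre_none hbv
    exact (hσ _ hb₀).trans (hι'.valOf_eq hi hO hO' b₀).symm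
  have hnone : (none : Option O.Trans) ∉ (O.extendIncl t Z).mapT '' C := by
    rintro ⟨e, -, he⟩
    cases he
  refine ⟨O.extend t Z, extendHom h t Z hZt, (O.extendIncl t Z).mapT '' C, ι', none, S',
    ⟨hO', ?_, ?_, ?_⟩, ⟨hconf, hC.2.image _⟩, Set.ncard_image_of_injective _ hb.injT, hinst, hS',
    hmark, rfl, hpre, hval⟩
  · change (extendHom h t Z hZt).mapMarking '' ((O.extendIncl t Z).mapMarking '' O.init) = N.init
    rw [Set.image_image, ← hS.2.1]
    refine Set.image_congr fun K _ => ?_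
    exact Multiset.map_map _ _ _
  · rintro (_ | e)
    · obtain ⟨-, ι'', hι'', -⟩ := hO'.exists_inst_insert hconf hinst hnone hpre
        (show (O.extend t Z).guard none σ from hg) hval
      exact ⟨ι'', hι''.2 none (Or.inl rfl)⟩
    · obtain ⟨ι₁, hι₁⟩ := hS.2.2.1 e
      obtain ⟨ι₂, hι₂⟩ := Hom.exists_extends hb.injP hb.injT hne ι₁
      exact ⟨ι₂, hι₂.pred hi hb hO hO' hι₁⟩
  · have hinj : Function.Injective
        (Multiset.map fun bv : O.Place × Var =>
          ((Sum.inl bv.1, bv.2) : (O.extend t Z).Place × Var)) :=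
      Multiset.map_injective (Function.Injective.prodMap Sum.inl_injective Function.injective_id)
    rintro (_ | e) (_ | e') hp ht
    · rfl
    · exact absurd ⟨e', (hinj hp).symm, ht.symm⟩ hex
    · exact absurd ⟨e, hinj hp, ht⟩ hex
    · exact congrArg some (hS.2.2.2 e e' (hinj hp) ht)

end Extension

/-! ### Realizing firing sequences by configurations -/

theorem exists_pairing {α β γ : Type} (f : β → γ) (g : α → γ) (T : Multiset β) (S : Multiset α)
    (h : T.map f ≤ S.map g) : ∃ Z : Multiset (α × β), Z.map Prod.snd = T ∧ Z.map Prod.fst ≤ S ∧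
      ∀ z ∈ Z, g z.1 = f z.2 := by
  induction T using Multiset.induction_on generalizing S with
  | empty => exact ⟨0, rfl, Multiset.zero_le _, by simp⟩
  | cons b T ih =>
    rw [Multiset.map_cons] at h
    obtain ⟨a, ha, hab⟩ := Multiset.mem_map.1 (Multiset.mem_of_le h (Multiset.mem_cons_self _ _))
    obtain ⟨S, rfl⟩ := Multiset.exists_cons_of_mem ha
    rw [Multiset.map_cons, hab, Multiset.cons_le_cons_iff] at h
    obtain ⟨Z, hZ1, hZ2, hZ3⟩ := ih S h
    refine ⟨(a, b) ::ₘ Z, by simp [hZ1], by simpa using hZ2, ?_⟩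
    intro z hz
    rcases Multiset.mem_cons.1 hz with rfl | hz
    · exact hab
    · exact hZ3 z hz

variable {N : HLNet Color Var}

theorem reach_of_reachSteps {k : ℕ} {M : N.Marking} (h : N.ReachSteps k M) : N.Reach M := by
  induction k generalizing M with
  | zero => exact Reach.init h
  | succ k ih =>
    obtain ⟨M₀, t, σ, h₀, hf⟩ := h
    exact Reach.step (ih h₀) hf

/-- In a safe net, firing a transition without input arcs does not change the marking. -/
theorem Safe.eq_of_pre_eq_zero (hsafe : N.Safe) {M M' : N.Marking} {t : N.Trans}
    {σ : Var → Color} (hM : N.Reach M) (ht : N.preFlow t = 0) (hf : N.firesTo M t σ M') :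
    M' = M := by
  have hpre : N.preMark t σ = 0 := by simp [preMark, ht]
  have hM' : M' = M + N.postMark t σ := by rw [hf.2, hpre, tsub_zero]
  have hf' : N.firesTo M' t σ (M' + N.postMark t σ) := by
    refine ⟨⟨hf.1.1, ?_⟩, ?_⟩
    · rw [hpre]
      exact Multiset.zero_le _
    · rw [hpre, tsub_zero]
  have hpost : N.postMark t σ = 0 := by
    by_contra hne
    obtain ⟨pc, hpc⟩ := Multiset.exists_mem_of_ne_zero hne
    have hs := hsafe _ ((hM.step hf).step hf') pc.1
    have hpos : 0 < ((N.postMark t σ).filter fun x => x.1 = pc.1).card :=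
      Multiset.card_pos_iff_exists_mem.2 ⟨pc, Multiset.mem_filter.2 ⟨hpc, rfl⟩⟩
    rw [hM', Multiset.filter_add, Multiset.filter_add, Multiset.card_add, Multiset.card_add] at hs
    omega
  rw [hM', hpost, add_zero]

/-- Every marking reached by `k` firings is represented, in some symbolic branching process, by a
configuration with at most `k` events. -/
theorem exists_sbp_config_of_reachSteps {O : HLNet Color Var} {h : Hom O N} (hsafe : N.Safe)
    (hS : IsSBP h) (hne : Nonempty O.Assign) {k : ℕ} {M : N.Marking} (hM : N.ReachSteps k M) :
    ∃ (O' : HLNet Color Var) (h' : Hom O' N) (C : Set O'.Trans), IsSBP h' ∧ O'.FinCfg C ∧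
      C.ncard ≤ k ∧ M ∈ marks h' C := by
  induction k generalizing M with
  | zero =>
    obtain ⟨K, hK, rfl⟩ : M ∈ h.mapMarking '' O.init := by
      rw [hS.2.1]
      exact hM
    obtain ⟨ι₀⟩ := hne
    let ι : O.Assign := fun x => match x with
      | Sum.inl y => ι₀ (Sum.inl y)
      | Sum.inr b => if hb : ∃ c, (b, c) ∈ K then hb.choose else ι₀ (Sum.inr b)
    have hι : ∀ (b : O.Place) (c : Color), (b, c) ∈ K → ι (Sum.inr b) = c := by
      intro b c hbc
      have hb : ∃ c, (b, c) ∈ K := ⟨c, hbc⟩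
      have hinj := Multiset.inj_on_of_nodup_map (hS.1.init_nodup hK) _ hb.choose_spec _ hbc rfl
      simp only [ι, dif_pos hb]
      exact congrArg Prod.snd hinj
    have hinst : O.IsInst ∅ ι := ⟨⟨K, hK, hι⟩, by simp⟩
    obtain ⟨S, hScut, hmark⟩ := hS.1.exists_cut_empty h hK hι
    exact ⟨O, h, ∅, hS, ⟨⟨by simp, by simp, ι, hinst⟩, Set.finite_empty⟩, by simp,
      mem_marks_iff.2 ⟨ι, hinst, S, hScut, hmark.symm⟩⟩
  | succ k ih =>
    obtain ⟨M₀, t, σ, hM₀, hf⟩ := hM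
    obtain ⟨O₁, h₁, C₁, hS₁, hC₁, hk, hmem⟩ := ih hM₀
    by_cases ht : N.preFlow t = 0
    · rw [hsafe.eq_of_pre_eq_zero (reach_of_reachSteps hM₀) ht hf]
      exact ⟨O₁, h₁, C₁, hS₁, hC₁, by omega, hmem⟩
    obtain ⟨ι₁, hι₁, S₁, hcut₁, rfl⟩ := mem_marks_iff.1 hmem
    obtain ⟨Y, hY1, hY2, hY3⟩ := exists_pairing _ _ _ _ hf.1.2
    have hZt : ((Y.map fun z => (z.1, z.2.2)).map fun bv => (h₁.mapP bv.1, bv.2)) =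
        N.preFlow t := by
      rw [← hY1, Multiset.map_map]
      refine Multiset.map_congr rfl fun z hz => ?_
      have hfst := congrArg Prod.fst (hY3 z hz)
      exact Prod.ext hfst rfl
    have hZfst : (Y.map fun z => (z.1, z.2.2)).map Prod.fst = Y.map Prod.fst := by
      rw [Multiset.map_map]
      rfl
    obtain ⟨O₂, h₂, C₂, ι₂, e, S₂, hS₂, hC₂, hcard, hι₂, hcut₂, hmark₂, he, hpre, hval⟩ :=
      hS₁.exists_event (t := t) (Z := Y.map fun z => (z.1, z.2.2)) (σ := σ) hC₁ hι₁ hcut₁ hZt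
        (by rw [hZfst]; exact Multiset.nodup_of_le hY2 S₁.nodup)
        (by
          intro bv hbv
          have h1 : bv.1 ∈ Y.map Prod.fst := hZfst ▸ Multiset.mem_map_of_mem Prod.fst hbv
          rw [← hcut₁]
          exact Multiset.mem_of_le hY2 h1)
        hf.1.1
        (by
          intro bv hbv
          obtain ⟨z, hz, rfl⟩ := Multiset.mem_map.1 hbv
          exact (congrArg Prod.snd (hY3 z hz)).symm)
    have heC : e ∉ C₂ := by
      intro heC
      have hne0 : O₂.preFlow e ≠ 0 := by
        intro h0
        apply ht
        rw [← he, h₂.pre_eq, h0, Multiset.map_zero]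
      obtain ⟨bv, hbv⟩ := Multiset.exists_mem_of_ne_zero hne0
      exact (hpre bv hbv).2 ⟨e, heC, bv.2, hbv⟩
    obtain ⟨hconf, ι', hι', hloc, hισ, hvalcut⟩ := hS₂.1.exists_inst_insert hC₂.1 hι₂ heC hpre
      ((h₂.guard_iff e σ).2 (he ▸ hf.1.1)) hval
    obtain ⟨S', hcut', hfire⟩ := hS₂.1.exists_cut_insert h₂ hC₂.1.1 heC hpre hloc hcut₂
    refine ⟨O₂, h₂, insert e C₂, hS₂, ⟨hconf, hC₂.2.insert e⟩, ?_,
      mem_marks_iff.2 ⟨ι', hι', S', hcut', ?_⟩⟩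
    · exact (Set.ncard_insert_le e C₂).trans (by omega)
    · have hsame : (S₂.val.map fun b => (h₂.mapP b, O₂.valOf ι' b)) =
          S₁.val.map fun b => (h₁.mapP b, O₁.valOf ι₁ b) := by
        rw [← hmark₂]
        refine Multiset.map_congr rfl fun b hb => ?_
        rw [hvalcut b (hcut₂ ▸ hb)]
      rw [hfire.2, hf.2, hsame, he, funext hισ]

/-- Every marking reached by `k` firings is represented in the symbolic unfolding by a
configuration with at most `k` events. -/
theorem IsUnfolding.exists_config_of_reachSteps {O : HLNet Color Var} {h : Hom O N}
    (hsafe : N.Safe) (hU : IsUnfolding h) (hne : Nonempty O.Assign) {k : ℕ} {M : N.Marking}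
    (hM : N.ReachSteps k M) : ∃ C : Set O.Trans, O.FinCfg C ∧ C.ncard ≤ k ∧ M ∈ marks h C := by
  obtain ⟨O', h', C, hS, hC, hk, hmem⟩ := exists_sbp_config_of_reachSteps hsafe hU.1 hne hM
  obtain ⟨φ, hi, injP, injT, hP, -⟩ := hU.2 O' h' hS
  have hb := hi.isBackClosed hS.1 hU.1.1 injP injT
  obtain ⟨ι, hι, S, hcut, rfl⟩ := mem_marks_iff.1 hmem
  obtain ⟨ι', hι'⟩ := Hom.exists_extends injP injT hne ι
  obtain ⟨S', hcut', hmark⟩ := hb.exists_cut_image hi hS.1 hU.1.1 hP hι' hcut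
  exact ⟨φ.mapT '' C, ⟨hι'.isConfig hi hb hS.1 hU.1.1 hC.1 hι, hC.2.image _⟩,
    (Set.ncard_image_of_injective C injT).trans_le hk,
    mem_marks_iff.2 ⟨ι', hι'.isInst hi hb hS.1 hU.1.1 hι, S', hcut', hmark.symm⟩⟩

theorem IsUnfolding.isCutoffStar_of_lt_ncard {O : HLNet Color Var} {h : Hom O N} {n : ℕ}
    (hsafe : N.Safe) (hbound : N.BoundedReach n) (hU : IsUnfolding h)
    {r : Set O.Trans → Set O.Trans → Prop}
    (hsz : ∀ C₁ C₂, O.FinCfg C₁ → O.FinCfg C₂ → C₁.ncard < C₂.ncard → r C₁ C₂)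
    {e : O.Trans} (he : n < (O.cone e).ncard) : IsCutoffStar h r e := by
  intro M hM
  have hO := hU.1.1
  obtain ⟨ι, hι, -⟩ := mem_marks_iff.1 hM
  have hcone := hO.cone_isConfig hι
  have hfin := hO.cone_finite e
  obtain ⟨k, hk, hsteps⟩ := hbound M (reach_of_finCfg hO hU.1.2.1 hcone hfin hM)
  obtain ⟨C, hC, hCk, hCM⟩ := hU.exists_config_of_reachSteps hsafe ⟨ι⟩ hsteps
  exact ⟨C, hC, hsz C _ hC ⟨hcone, hfin⟩ (by omega), hCM⟩

theorem IsOccNet.lt_ncard_cone_of_chain {O : HLNet Color Var} (hO : O.IsOccNet) {n : ℕ}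
    {f : Fin (n + 1) → O.Trans} (hf : ∀ i j, i < j → O.evLT (f i) (f j)) :
    n < (O.cone (f (Fin.last n))).ncard := by
  have hinj : Function.Injective f := by
    intro i j hij
    by_contra hne
    rcases lt_or_gt_of_ne hne with hlt | hlt
    · exact hO.evLT_irrefl (f j) (hij ▸ hf i j hlt)
    · exact hO.evLT_irrefl (f j) (hij ▸ hf j i hlt)
  have hsub : Set.range f ⊆ O.cone (f (Fin.last n)) := by
    rintro _ ⟨i, rfl⟩
    rcases (Fin.le_last i).eq_or_lt with rfl | hlt
    · exact evLE_refl _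
    · exact (hf _ _ hlt).evLE
  have hcard := Set.ncard_le_ncard hsub (hO.cone_finite _)
  rw [← Set.image_univ, Set.ncard_image_of_injective _ hinj, Set.ncard_univ, Nat.card_fin] at hcard
  omega

end HLNet

/-- Let `N` be a symbolically compact high-level Petri net with bound
`n` on the number of transition firings needed to reach every reachable marking, and
let `≺` be an adequate order on the finite configurations of its symbolic unfolding
`Υ = (O, h)` satisfying `|C1| < |C2| ⇒ C1 ≺ C2`. Then for every chain of events
`e1 < e2 < … < e_{n+1}` in `Υ`, the event `e_{n+1}` is a cut-off* event; consequently
every event `e` in the prefix of `Υ` containing no proper cut-off* predecessors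
satisfies `depth(e) ≤ n + 1`. -/
theorem chain_top_is_cutoff_star_and_depth_bound {Color Var : Type}
    (N O : HLNet Color Var) (h : HLNet.Hom O N)
    (hfinN : N.NetFinite) (hwf : N.WellFormed) (hsafe : N.Safe)
    (hdec : N.DecidableGuards) (n : ℕ) (hbound : N.BoundedReach n)
    (hU : HLNet.IsUnfolding h)
    (r : Set O.Trans → Set O.Trans → Prop) (hr : HLNet.IsAdequate h r)
    (hsz : ∀ C1 C2, O.FinCfg C1 → O.FinCfg C2 → C1.ncard < C2.ncard → r C1 C2) :
    (∀ f : Fin (n + 1) → O.Trans, (∀ i j, i < j → O.evLT (f i) (f j)) →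
        HLNet.IsCutoffStar h r (f (Fin.last n))) ∧
    (∀ e ∈ HLNet.finEventsStar h r, ∀ (k : ℕ) (f : Fin (k + 1) → O.Trans),
        (∀ i j, i < j → O.evLT (f i) (f j)) → f (Fin.last k) = e → k + 1 ≤ n + 1) := by
  have hO := hU.1.1
  have key : ∀ f : Fin (n + 1) → O.Trans, (∀ i j, i < j → O.evLT (f i) (f j)) →
      HLNet.IsCutoffStar h r (f (Fin.last n)) := fun f hf =>
    hU.isCutoffStar_of_lt_ncard hsafe hbound hsz (hO.lt_ncard_cone_of_chain hf)
  refine ⟨key, fun e he k f hf hfe => ?_⟩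
  by_contra hk
  have hnk : n + 1 ≤ k + 1 := by omega
  have hlt : O.evLT (f (Fin.castLE hnk (Fin.last n))) e := by
    rw [← hfe]
    refine hf _ _ ?_
    rw [Fin.lt_def, Fin.val_castLE, Fin.val_last, Fin.val_last]
    omega
  refine he _ hlt.evLE ?_ (key (fun i => f (Fin.castLE hnk i)) fun i j hij => hf _ _ hij)
  intro heq
  rw [heq] at hlt
  exact hO.evLT_irrefl e hlt
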